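/- arXiv:1107.2636 — 2 statements merged into one kernel-verified Lean document; each statement's English description precedes it below -/
import Mathlib

section
/- Let p ∈ (0,1) satisfy 1 − p + p(1−p)^2 > 1/4. Then with probability tending to 1 as n → ∞ there is a bad 2^{-n} × 2^{-n} square, hence lim_{n→∞} T_n(p) = 0. Consequently p_c ≥ 0.785996. -/
open Set Filter Topology

noncomputable section

/-- The dyadic tile `[a/2^i, (a+1)/2^i] × [b/2^j, (b+1)/2^j]` as a subset of `ℝ × ℝ`. -/
def dyadicTile (i j a b : ℕ) : Set (ℝ × ℝ) :=
  Set.Icc ((a : ℝ) / 2 ^ i) (((a : ℝ) + 1) / 2 ^ i) ×ˢ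
    Set.Icc ((b : ℝ) / 2 ^ j) (((b : ℝ) + 1) / 2 ^ j)

/-- `t` is a dyadic tile of order `n` contained in the unit square. -/
def IsDyadicTile (n : ℕ) (t : Set (ℝ × ℝ)) : Prop :=
  ∃ i j a b : ℕ, i + j = n ∧ a < 2 ^ i ∧ b < 2 ^ j ∧ t = dyadicTile i j a b

/-- `F` is a tiling of the region `R` by dyadic tiles of order `n`:
a set of order-`n` tiles whose union is `R` and whose interiors are pairwise disjoint. -/
def IsTiling (n : ℕ) (F : Set (Set (ℝ × ℝ))) (R : Set (ℝ × ℝ)) : Prop :=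
  (∀ t ∈ F, IsDyadicTile n t) ∧ ⋃₀ F = R ∧
    F.Pairwise fun s t => interior s ∩ interior t = ∅

def unitSquare : Set (ℝ × ℝ) := Set.Icc (0 : ℝ) 1 ×ˢ Set.Icc (0 : ℝ) 1

/-- Index type for the dyadic tiles of order `n`: a shape `i` (width `2^{-i}`, height
`2^{-(n-i)}`) together with the horizontal and vertical positions. -/
abbrev TileIndex (n : ℕ) : Type :=
  Σ i : Fin (n + 1), Fin (2 ^ (i : ℕ)) × Fin (2 ^ (n - (i : ℕ)))

/-- The order-`n` tile corresponding to an index. -/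
def tileOf (n : ℕ) (x : TileIndex n) : Set (ℝ × ℝ) :=
  dyadicTile (x.1 : ℕ) (n - (x.1 : ℕ)) (x.2.1 : ℕ) (x.2.2 : ℕ)

/-- The set `S` of available order-`n` tiles admits a tiling of the unit square. -/
def TileableSquare (n : ℕ) (S : Finset (TileIndex n)) : Prop :=
  ∃ F : Set (Set (ℝ × ℝ)), (∀ t ∈ F, ∃ x ∈ S, t = tileOf n x) ∧ IsTiling n F unitSquare

open Classical in
/-- Probability of the event `E` when each of the `(n+1)·2^n` order-`n` dyadic tiles is
available independently with probability `p`. -/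
def Pr (n : ℕ) (p : ℝ) (E : Finset (TileIndex n) → Prop) : ℝ :=
  ∑ S : Finset (TileIndex n),
    if E S then p ^ S.card * (1 - p) ^ ((n + 1) * 2 ^ n - S.card) else 0

/-- `T n p`: the probability that some set of available order-`n` tiles tiles `[0,1]²`. -/
def T (n : ℕ) (p : ℝ) : ℝ := Pr n p (TileableSquare n)

/-- The critical probability `p_c`. -/
def pc : ℝ :=
  sInf {p : ℝ | p ∈ Set.Icc (0 : ℝ) 1 ∧ Tendsto (fun n => T n p) atTop (𝓝 1)}


/-- The closed square `[a/2^n, (a+1)/2^n] × [b/2^n, (b+1)/2^n]` of side `2^{-n}`. -/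
def smallSquare (n a b : ℕ) : Set (ℝ × ℝ) :=
  Set.Icc ((a : ℝ) / 2 ^ n) (((a : ℝ) + 1) / 2 ^ n) ×ˢ
    Set.Icc ((b : ℝ) / 2 ^ n) (((b : ℝ) + 1) / 2 ^ n)

/-- The event that some `2^{-n} × 2^{-n}` square is bad: every available order-`n` tile
covering it has no available friend (a friend of `s` being a tile `t` with `s ∪ t` a tile
of order `n - 1`). -/
def BadSquareExists (n : ℕ) (S : Finset (TileIndex n)) : Prop :=
  ∃ a b : ℕ, a < 2 ^ n ∧ b < 2 ^ n ∧
    ∀ i ∈ S, smallSquare n a b ⊆ tileOf n i →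
      ∀ j ∈ S, ¬ IsDyadicTile (n - 1) (tileOf n i ∪ tileOf n j)

/-- The expectation of `f S` when `S` contains each point of `α` independently with
probability `p`. -/
def bernoulliExp {α : Type*} [Fintype α] (p : ℝ) (f : Finset α → ℝ) : ℝ :=
  ∑ S : Finset α, p ^ S.card * (1 - p) ^ (Fintype.card α - S.card) * f S

/-- The value of `f S` depends only on `S ∩ A`. -/
def DeterminedBy {α : Type*} [DecidableEq α] (f : Finset α → ℝ) (A : Finset α) : Prop :=
  ∀ S, f S = f (S ∩ A)

theorem sum_powerset_bernoulli {α : Type*} (p : ℝ) (A : Finset α) :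
    ∑ U ∈ A.powerset, p ^ U.card * (1 - p) ^ (A.card - U.card) = 1 := by
  rw [Finset.sum_pow_mul_eq_add_pow]
  simp

section DeterminedBy

variable {α : Type*} [DecidableEq α]

theorem DeterminedBy.mono {f : Finset α → ℝ} {A B : Finset α} (hf : DeterminedBy f A)
    (hAB : A ⊆ B) : DeterminedBy f B := by
  intro S
  rw [hf S, hf (S ∩ B), Finset.inter_assoc, Finset.inter_eq_right.2 hAB]

theorem DeterminedBy.mul {f g : Finset α → ℝ} {A : Finset α} (hf : DeterminedBy f A)
    (hg : DeterminedBy g A) : DeterminedBy (fun S => f S * g S) A := by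
  intro S
  simp only [← hf S, ← hg S]

theorem DeterminedBy.prod {ι : Type*} [DecidableEq ι] {s : Finset ι} {f : ι → Finset α → ℝ}
    {A : ι → Finset α} (hf : ∀ i ∈ s, DeterminedBy (f i) (A i)) :
    DeterminedBy (fun S => ∏ i ∈ s, f i S) (s.biUnion A) := by
  intro S
  exact Finset.prod_congr rfl fun i hi =>
    (hf i hi).mono (Finset.subset_biUnion_of_mem A hi) S

theorem determinedBy_mem (t : α) :
    DeterminedBy (fun S : Finset α => if t ∈ S then (1 : ℝ) else 0) {t} := by
  intro S
  simp

theorem determinedBy_notMem (t : α) :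
    DeterminedBy (fun S : Finset α => if t ∈ S then (0 : ℝ) else 1) {t} := by
  intro S
  simp

end DeterminedBy

section BernoulliExp

variable {α : Type*} [Fintype α] {p : ℝ}

theorem bernoulliExp_add (f g : Finset α → ℝ) :
    bernoulliExp p (fun S => f S + g S) = bernoulliExp p f + bernoulliExp p g := by
  simp [bernoulliExp, mul_add, Finset.sum_add_distrib]

theorem bernoulliExp_sum {ι : Type*} (s : Finset ι) (f : ι → Finset α → ℝ) :
    bernoulliExp p (fun S => ∑ i ∈ s, f i S) = ∑ i ∈ s, bernoulliExp p (f i) := by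
  simp only [bernoulliExp, Finset.mul_sum]
  exact Finset.sum_comm

theorem bernoulliExp_const_mul (c : ℝ) (f : Finset α → ℝ) :
    bernoulliExp p (fun S => c * f S) = c * bernoulliExp p f := by
  simp only [bernoulliExp, Finset.mul_sum]
  exact Finset.sum_congr rfl fun S _ => by ring

theorem bernoulliExp_const (c : ℝ) : bernoulliExp p (fun _ : Finset α => c) = c := by
  have h := Fintype.sum_pow_mul_eq_add_pow α p (1 - p)
  simp only [bernoulliExp, ← Finset.sum_mul, h]
  simp

theorem bernoulliExp_mono (hp0 : 0 ≤ p) (hp1 : p ≤ 1) {f g : Finset α → ℝ}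
    (h : ∀ S, f S ≤ g S) : bernoulliExp p f ≤ bernoulliExp p g := by
  have hp : 0 ≤ 1 - p := by linarith
  exact Finset.sum_le_sum fun S _ => mul_le_mul_of_nonneg_left (h S) (by positivity)

variable [DecidableEq α]

theorem bernoulliExp_mul_of_compl {f g : Finset α → ℝ} {A : Finset α}
    (hf : DeterminedBy f A) (hg : DeterminedBy g Aᶜ) :
    bernoulliExp p (fun S => f S * g S) =
      (∑ U ∈ A.powerset, p ^ U.card * (1 - p) ^ (A.card - U.card) * f U) *
      ∑ V ∈ Aᶜ.powerset, p ^ V.card * (1 - p) ^ (Aᶜ.card - V.card) * g V := by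
  rw [Finset.sum_mul_sum, ← Finset.sum_product', bernoulliExp]
  refine Finset.sum_nbij' (fun S => (S ∩ A, S ∩ Aᶜ)) (fun x => x.1 ∪ x.2) ?_ ?_ ?_ ?_ ?_
  · intro S _
    simp [Finset.inter_subset_right]
  · simp
  · intro S _
    simp [← Finset.inter_union_distrib_left]
  · rintro ⟨U, V⟩ h
    simp only [Finset.mem_product, Finset.mem_powerset] at h
    obtain ⟨hU, hV⟩ := h
    ext x
    · have := @hU x
      have := @hV x
      simp only [Finset.mem_compl] at *
      simp only [Finset.mem_inter, Finset.mem_union]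
      tauto
    · have := @hU x
      have := @hV x
      simp only [Finset.mem_compl] at *
      simp only [Finset.mem_inter, Finset.mem_union, Finset.mem_compl]
      tauto
  · intro S _
    have hd : Disjoint (S ∩ A) (S ∩ Aᶜ) :=
      disjoint_compl_right.mono Finset.inter_subset_right Finset.inter_subset_right
    have hS : S.card = (S ∩ A).card + (S ∩ Aᶜ).card := by
      rw [← Finset.card_union_of_disjoint hd, ← Finset.inter_union_distrib_left]
      simp
    have h1 : (S ∩ A).card ≤ A.card := Finset.card_le_card Finset.inter_subset_right
    have h2 : (S ∩ Aᶜ).card ≤ Aᶜ.card := Finset.card_le_card Finset.inter_subset_right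
    have h3 := Finset.card_add_card_compl A
    have h4 : Fintype.card α - S.card =
        (A.card - (S ∩ A).card) + (Aᶜ.card - (S ∩ Aᶜ).card) := by omega
    rw [h4, hS, pow_add, pow_add, hf S, hg S]
    ring

theorem bernoulliExp_eq_sum_powerset {f : Finset α → ℝ} {A : Finset α}
    (hf : DeterminedBy f A) :
    bernoulliExp p f = ∑ U ∈ A.powerset, p ^ U.card * (1 - p) ^ (A.card - U.card) * f U := by
  have h := bernoulliExp_mul_of_compl (p := p) hf (g := fun _ => 1) fun _ => rfl
  simpa [sum_powerset_bernoulli] using h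

theorem bernoulliExp_mul {f g : Finset α → ℝ} {A B : Finset α}
    (hf : DeterminedBy f A) (hg : DeterminedBy g B) (hAB : Disjoint A B) :
    bernoulliExp p (fun S => f S * g S) = bernoulliExp p f * bernoulliExp p g := by
  have hg' : DeterminedBy g Aᶜ := hg.mono hAB.symm.le_compl_right
  rw [bernoulliExp_mul_of_compl hf hg', bernoulliExp_eq_sum_powerset hf,
    bernoulliExp_eq_sum_powerset hg']

theorem bernoulliExp_prod {ι : Type*} [DecidableEq ι] (s : Finset ι) {f : ι → Finset α → ℝ}
    {A : ι → Finset α} (hf : ∀ i ∈ s, DeterminedBy (f i) (A i))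
    (hA : (s : Set ι).PairwiseDisjoint A) :
    bernoulliExp p (fun S => ∏ i ∈ s, f i S) = ∏ i ∈ s, bernoulliExp p (f i) := by
  induction s using Finset.induction_on with
  | empty => simpa using bernoulliExp_const (α := α) (p := p) 1
  | insert i s hi ih =>
    have hs : ∀ j ∈ s, DeterminedBy (f j) (A j) := fun j hj => hf j (Finset.mem_insert_of_mem hj)
    simp only [Finset.prod_insert hi]
    rw [bernoulliExp_mul (hf i (Finset.mem_insert_self i s)) (DeterminedBy.prod hs),
      ih hs (hA.subset (by simp))]
    rw [Finset.disjoint_biUnion_right]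
    intro j hj
    exact hA (by simp) (by simp [hj]) (by rintro rfl; exact hi hj)

theorem bernoulliExp_mem (t : α) :
    bernoulliExp p (fun S : Finset α => if t ∈ S then (1 : ℝ) else 0) = p := by
  rw [bernoulliExp_eq_sum_powerset (determinedBy_mem t), ← insert_empty_eq,
    Finset.sum_powerset_insert (by simp)]
  simp

theorem bernoulliExp_notMem (t : α) :
    bernoulliExp p (fun S : Finset α => if t ∈ S then (0 : ℝ) else 1) = 1 - p := by
  rw [bernoulliExp_eq_sum_powerset (determinedBy_notMem t), ← insert_empty_eq,
    Finset.sum_powerset_insert (by simp)]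
  simp

theorem bernoulliExp_isolated_ge (hp0 : 0 ≤ p) (hp1 : p ≤ 1) {t : α} {N : Finset α} (ht : t ∉ N)
    (hN : N.card ≤ 2) :
    1 - p + p * (1 - p) ^ 2 ≤
      bernoulliExp p (fun S => if t ∈ S ∧ ¬ Disjoint S N then (0 : ℝ) else 1) := by
  have hdet : DeterminedBy (fun S : Finset α => ∏ v ∈ N, if v ∈ S then (0 : ℝ) else 1) N := by
    simpa using DeterminedBy.prod (s := N) (A := fun v => {v}) fun v _ => determinedBy_notMem v
  have hN' : bernoulliExp p (fun S : Finset α => ∏ v ∈ N, if v ∈ S then (0 : ℝ) else 1) =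
      (1 - p) ^ N.card := by
    rw [bernoulliExp_prod (A := fun v => {v}) N fun v _ => determinedBy_notMem v]
    · simp [bernoulliExp_notMem]
    · intro a _ b _ hab
      simpa using hab
  have hmul := bernoulliExp_mul (p := p) (determinedBy_mem t) hdet (by simpa using ht)
  rw [bernoulliExp_mem, hN'] at hmul
  have hsum : bernoulliExp p (fun S => (if t ∈ S then (0 : ℝ) else 1) +
      (if t ∈ S then (1 : ℝ) else 0) * ∏ v ∈ N, if v ∈ S then (0 : ℝ) else 1) =
      1 - p + p * (1 - p) ^ N.card := by
    rw [bernoulliExp_add, bernoulliExp_notMem, hmul]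
  calc 1 - p + p * (1 - p) ^ 2 ≤ 1 - p + p * (1 - p) ^ N.card := by
        have := pow_le_pow_of_le_one (a := 1 - p) (by linarith) (by linarith) hN
        gcongr
    _ ≤ _ := by
        rw [← hsum]
        refine bernoulliExp_mono hp0 hp1 fun S => ?_
        by_cases h : t ∈ S
        · by_cases hd : Disjoint S N
          · have : ∏ v ∈ N, (if v ∈ S then (0 : ℝ) else 1) ≤ 1 :=
              Finset.prod_le_one (fun v _ => by split_ifs <;> norm_num)
                fun v _ => by split_ifs <;> norm_num
            simpa [h, hd] using this
          · obtain ⟨v, hvS, hvN⟩ := Finset.not_disjoint_iff.1 hd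
            have : ∏ v ∈ N, (if v ∈ S then (0 : ℝ) else 1) = 0 :=
              Finset.prod_eq_zero hvN (by simp [hvS])
            simp [h, hd, this]
        · simp [h]

end BernoulliExp

section Tiles

variable {n : ℕ}

/-- The cells of the `2^n × 2^n` grid. -/
abbrev Cell (n : ℕ) : Type := Fin (2 ^ n) × Fin (2 ^ n)

theorem TileIndex.ext_nat {u v : TileIndex n} (h : (u.1 : ℕ) = v.1)
    (ha : (u.2.1 : ℕ) = v.2.1) (hb : (u.2.2 : ℕ) = v.2.2) : u = v := by
  obtain ⟨k, a, b⟩ := u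
  obtain ⟨k', a', b'⟩ := v
  obtain rfl : k = k' := Fin.ext h
  obtain rfl : a = a' := Fin.ext ha
  obtain rfl : b = b' := Fin.ext hb
  rfl

/-- The tile of shape `k` that covers the cell `c`. -/
def coverTile (k : Fin (n + 1)) (c : Cell n) : TileIndex n :=
  ⟨k, ⟨c.1 / 2 ^ (n - (k : ℕ)), Nat.div_lt_of_lt_mul <| by
      rw [← pow_add, Nat.sub_add_cancel (Nat.lt_succ_iff.1 k.2)]; exact c.1.2⟩,
    ⟨c.2 / 2 ^ (k : ℕ), Nat.div_lt_of_lt_mul <| by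
      rw [← pow_add, Nat.add_sub_cancel' (Nat.lt_succ_iff.1 k.2)]; exact c.2.2⟩⟩

/-- Combinatorial description of friends: `v` is the horizontal or vertical sibling of `u`. -/
def IsFriend (u v : TileIndex n) : Prop :=
  u.1 = v.1 ∧ u ≠ v ∧
    (((u.2.1 : ℕ) / 2 = v.2.1 / 2 ∧ (u.2.2 : ℕ) = v.2.2) ∨
      ((u.2.1 : ℕ) = v.2.1 ∧ (u.2.2 : ℕ) / 2 = v.2.2 / 2))

/-- No tile of `S` covering `c` has a friend in `S`. -/
def IsBadCell (c : Cell n) (S : Finset (TileIndex n)) : Prop :=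
  ∀ k, coverTile k c ∈ S → ∀ v ∈ S, ¬ IsFriend (coverTile k c) v

open Classical in
/-- The friends of a tile. -/
def friends (u : TileIndex n) : Finset (TileIndex n) := {v | IsFriend u v}

theorem mem_friends {u v : TileIndex n} : v ∈ friends u ↔ IsFriend u v := by
  classical
  simp [friends]

theorem notMem_friends (u : TileIndex n) : u ∉ friends u := by
  simp [mem_friends, IsFriend]

theorem card_friends_le (u : TileIndex n) : (friends u).card ≤ 2 := by
  classical
  set H : Finset (TileIndex n) := {v | u.1 = v.1 ∧ u ≠ v ∧
    (u.2.1 : ℕ) / 2 = v.2.1 / 2 ∧ (u.2.2 : ℕ) = v.2.2}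
  set V : Finset (TileIndex n) := {v | u.1 = v.1 ∧ u ≠ v ∧
    (u.2.1 : ℕ) = v.2.1 ∧ (u.2.2 : ℕ) / 2 = v.2.2 / 2}
  have hsub : friends u ⊆ H ∪ V := by
    intro v
    simp only [mem_friends, IsFriend, H, V, Finset.mem_filter, Finset.mem_union, Finset.mem_univ]
    tauto
  have hH : H.card ≤ 1 := by
    rw [Finset.card_le_one]
    intro v hv w hw
    simp only [H, Finset.mem_filter, Finset.mem_univ, true_and] at hv hw
    obtain ⟨h1, h2, h3, h4⟩ := hv
    obtain ⟨g1, g2, g3, g4⟩ := hw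
    have h5 : (u.2.1 : ℕ) ≠ v.2.1 := fun h => h2 (TileIndex.ext_nat (by rw [h1]) h h4)
    have g5 : (u.2.1 : ℕ) ≠ w.2.1 := fun h => g2 (TileIndex.ext_nat (by rw [g1]) h g4)
    exact TileIndex.ext_nat (by rw [← h1, g1]) (by omega) (by omega)
  have hV : V.card ≤ 1 := by
    rw [Finset.card_le_one]
    intro v hv w hw
    simp only [V, Finset.mem_filter, Finset.mem_univ, true_and] at hv hw
    obtain ⟨h1, h2, h3, h4⟩ := hv
    obtain ⟨g1, g2, g3, g4⟩ := hw
    have h5 : (u.2.2 : ℕ) ≠ v.2.2 := fun h => h2 (TileIndex.ext_nat (by rw [h1]) h3 h)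
    have g5 : (u.2.2 : ℕ) ≠ w.2.2 := fun h => g2 (TileIndex.ext_nat (by rw [g1]) g3 h)
    exact TileIndex.ext_nat (by rw [← h1, g1]) (by omega) (by omega)
  have := Finset.card_le_card hsub
  have := Finset.card_union_le H V
  omega

theorem exists_sibling {N m x : ℕ} (hm : m < N) (hx : x < 2 ^ N) :
    ∃ x' < 2 ^ N, x' / 2 ^ (m + 1) = x / 2 ^ (m + 1) ∧ x' / 2 ^ m ≠ x / 2 ^ m := by
  refine ⟨x ^^^ 2 ^ m, Nat.xor_lt_two_pow hx (Nat.pow_lt_pow_right (by norm_num) hm), ?_, ?_⟩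
  · simp only [← Nat.shiftRight_eq_div_pow]
    apply Nat.eq_of_testBit_eq
    intro i
    simp only [Nat.testBit_shiftRight, Nat.testBit_xor, Nat.testBit_two_pow]
    have : m ≠ m + 1 + i := by omega
    simp [this]
  · intro h
    simp only [← Nat.shiftRight_eq_div_pow] at h
    have := congrArg (fun z => Nat.testBit z 0) h
    simp [Nat.testBit_xor] at this

theorem div_pow_eq_of_le {x y m m' : ℕ} (h : x / 2 ^ m = y / 2 ^ m) (hm : m ≤ m') :
    x / 2 ^ m' = y / 2 ^ m' := by
  obtain ⟨d, rfl⟩ := Nat.exists_eq_add_of_le hm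
  rw [pow_add, ← Nat.div_div_eq_div_mul, ← Nat.div_div_eq_div_mul, h]

theorem coverTile_eq_iff {k : Fin (n + 1)} {c d : Cell n} :
    coverTile k c = coverTile k d ↔
      (c.1 : ℕ) / 2 ^ (n - (k : ℕ)) = d.1 / 2 ^ (n - (k : ℕ)) ∧
      (c.2 : ℕ) / 2 ^ (k : ℕ) = d.2 / 2 ^ (k : ℕ) := by
  simp [coverTile]

/-- If a set of tiles covers each cell exactly once, then the tile covering any given cell
has a friend in the set. -/
theorem exists_friend_of_exact_cover (hn : 1 ≤ n) {G : Set (TileIndex n)}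
    (hcov : ∀ c, ∃ k, coverTile k c ∈ G)
    (huniq : ∀ c k k', coverTile k c ∈ G → coverTile k' c ∈ G → k = k')
    {c : Cell n} {k : Fin (n + 1)} (hc : coverTile k c ∈ G) :
    ∃ v ∈ G, IsFriend (coverTile k c) v := by
  by_contra! hno
  have hor : 1 ≤ (k : ℕ) → ∃ x' : Fin (2 ^ n), ∃ k', k < k' ∧ coverTile k' (x', c.2) ∈ G ∧
      (x' : ℕ) / 2 ^ (n - (k : ℕ) + 1) = c.1 / 2 ^ (n - (k : ℕ) + 1) := by
    intro hk
    obtain ⟨x', hx', h1, h2⟩ := exists_sibling (m := n - (k : ℕ)) (by omega) c.1.2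
    obtain ⟨k', hk'⟩ := hcov (⟨x', hx'⟩, c.2)
    refine ⟨⟨x', hx'⟩, k', ?_, hk', h1⟩
    rcases lt_trichotomy k k' with h | h | h
    · exact h
    · subst h
      refine absurd ⟨rfl, ?_, Or.inl ⟨?_, rfl⟩⟩ (hno _ hk')
      · intro h
        exact h2 (coverTile_eq_iff.1 h).1.symm
      · simp only [coverTile, Nat.div_div_eq_div_mul, ← pow_succ]
        exact h1.symm
    · have h' : coverTile k' (⟨x', hx'⟩, c.2) = coverTile k' c :=
        coverTile_eq_iff.2 ⟨div_pow_eq_of_le h1 (by omega), rfl⟩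
      exact absurd (huniq c k k' hc (h' ▸ hk')) h.ne'
  have ver : (k : ℕ) < n → ∃ y' : Fin (2 ^ n), ∃ k', k' < k ∧ coverTile k' (c.1, y') ∈ G ∧
      (y' : ℕ) / 2 ^ ((k : ℕ) + 1) = c.2 / 2 ^ ((k : ℕ) + 1) := by
    intro hk
    obtain ⟨y', hy', h1, h2⟩ := exists_sibling (m := (k : ℕ)) hk c.2.2
    obtain ⟨k', hk'⟩ := hcov (c.1, ⟨y', hy'⟩)
    refine ⟨⟨y', hy'⟩, k', ?_, hk', h1⟩
    rcases lt_trichotomy k k' with h | h | h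
    · have h' : coverTile k' (c.1, ⟨y', hy'⟩) = coverTile k' c :=
        coverTile_eq_iff.2 ⟨rfl, div_pow_eq_of_le h1 (by omega)⟩
      exact absurd (huniq c k k' hc (h' ▸ hk')) h.ne
    · subst h
      refine absurd ⟨rfl, ?_, Or.inr ⟨rfl, ?_⟩⟩ (hno _ hk')
      · intro h
        exact h2 (coverTile_eq_iff.1 h).2.symm
      · simp only [coverTile, Nat.div_div_eq_div_mul, ← pow_succ]
        exact h1.symm
    · exact h
  have hk1 : 1 ≤ (k : ℕ) := by
    by_contra h
    obtain ⟨_, k', hlt, _⟩ := ver (by omega)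
    omega
  have hkn : (k : ℕ) < n := by
    by_contra h
    obtain ⟨_, k', hlt, _⟩ := hor (by omega)
    omega
  obtain ⟨x', k1, hlt1, hk1, hx'⟩ := hor hk1
  obtain ⟨y', k2, hlt2, hk2, hy'⟩ := ver hkn
  have e1 : coverTile k1 (x', c.2) = coverTile k1 (x', y') :=
    coverTile_eq_iff.2 ⟨rfl, (div_pow_eq_of_le hy' (by omega)).symm⟩
  have e2 : coverTile k2 (c.1, y') = coverTile k2 (x', y') :=
    coverTile_eq_iff.2 ⟨(div_pow_eq_of_le hx' (by omega)).symm, rfl⟩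
  have := huniq (x', y') k1 k2 (e1 ▸ hk1) (e2 ▸ hk2)
  omega

/-- The centre of the cell `(x, y)`. -/
def cellCenter (n x y : ℕ) : ℝ × ℝ :=
  ((2 * x + 1) / 2 ^ (n + 1), (2 * y + 1) / 2 ^ (n + 1))

theorem center_mem_Icc {i x a : ℕ} (hi : i ≤ n)
    (h : ((2 * x + 1) / 2 ^ (n + 1) : ℝ) ∈ Set.Icc ((a : ℝ) / 2 ^ i) (((a : ℝ) + 1) / 2 ^ i)) :
    x / 2 ^ (n - i) = a := by
  obtain ⟨m, rfl⟩ := Nat.exists_eq_add_of_le hi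
  rw [Set.mem_Icc, div_le_div_iff₀ (by positivity) (by positivity),
    div_le_div_iff₀ (by positivity) (by positivity)] at h
  obtain ⟨h1, h2⟩ := h
  rw [Nat.add_sub_cancel_left]
  have hp : (0 : ℝ) < 2 ^ i := by positivity
  have e : (2 : ℝ) ^ (i + m + 1) = 2 ^ i * (2 ^ m * 2) := by ring
  rw [e] at h1 h2
  have h1' : (a : ℝ) * (2 ^ m * 2) ≤ 2 * x + 1 := by
    refine le_of_mul_le_mul_right ?_ hp
    linarith
  have h2' : (2 * x + 1 : ℝ) ≤ (a + 1) * (2 ^ m * 2) := by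
    refine le_of_mul_le_mul_right ?_ hp
    linarith
  norm_cast at h1' h2'
  rw [Nat.div_eq_iff (by positivity)]
  generalize 2 ^ m = M at *
  rw [← mul_assoc] at h1' h2'
  have := Nat.add_one_mul a M
  omega

theorem center_mem_Ioo {i x a : ℕ} (hi : i ≤ n) (h : x / 2 ^ (n - i) = a) :
    ((2 * x + 1) / 2 ^ (n + 1) : ℝ) ∈ Set.Ioo ((a : ℝ) / 2 ^ i) (((a : ℝ) + 1) / 2 ^ i) := by
  obtain ⟨m, rfl⟩ := Nat.exists_eq_add_of_le hi
  rw [Nat.add_sub_cancel_left] at h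
  have h1 : a * 2 ^ m ≤ x := h ▸ Nat.div_mul_le_self x _
  have h2 : x < (a + 1) * 2 ^ m := by
    rw [← h, mul_comm]
    exact Nat.lt_mul_div_succ x (by positivity)
  have h1' : (a : ℝ) * 2 ^ m ≤ x := by exact_mod_cast h1
  have h2' : (x : ℝ) + 1 ≤ (a + 1) * 2 ^ m := by exact_mod_cast h2
  have hp : (0 : ℝ) < 2 ^ i := by positivity
  have e : (2 : ℝ) ^ (i + m + 1) = 2 ^ m * 2 * 2 ^ i := by ring
  rw [Set.mem_Ioo, div_lt_div_iff₀ (by positivity) (by positivity),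
    div_lt_div_iff₀ (by positivity) (by positivity), e]
  have h3 : (a : ℝ) * 2 ^ m * 2 * 2 ^ i < (2 * x + 1) * 2 ^ i :=
    mul_lt_mul_of_pos_right (by linarith) hp
  have h4 : (2 * x + 1 : ℝ) * 2 ^ i < (a + 1) * 2 ^ m * 2 * 2 ^ i :=
    mul_lt_mul_of_pos_right (by linarith) hp
  constructor <;> linarith

theorem center_mem_dyadicTile_iff {i j a b x y : ℕ} (hi : i ≤ n) (hj : j ≤ n) :
    cellCenter n x y ∈ dyadicTile i j a b ↔ x / 2 ^ (n - i) = a ∧ y / 2 ^ (n - j) = b :=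
  ⟨fun h => ⟨center_mem_Icc hi h.1, center_mem_Icc hj h.2⟩, fun h =>
    ⟨Set.Ioo_subset_Icc_self (center_mem_Ioo hi h.1),
      Set.Ioo_subset_Icc_self (center_mem_Ioo hj h.2)⟩⟩

theorem center_mem_interior_dyadicTile {i j a b x y : ℕ} (hi : i ≤ n) (hj : j ≤ n)
    (hx : x / 2 ^ (n - i) = a) (hy : y / 2 ^ (n - j) = b) :
    cellCenter n x y ∈ interior (dyadicTile i j a b) := by
  rw [dyadicTile, interior_prod_eq, interior_Icc, interior_Icc]
  exact ⟨center_mem_Ioo hi hx, center_mem_Ioo hj hy⟩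

theorem center_mem_tileOf_iff {u : TileIndex n} {x y : ℕ} :
    cellCenter n x y ∈ tileOf n u ↔
      x / 2 ^ (n - (u.1 : ℕ)) = u.2.1 ∧ y / 2 ^ (u.1 : ℕ) = u.2.2 := by
  have hk := Nat.lt_succ_iff.1 u.1.2
  rw [tileOf, center_mem_dyadicTile_iff hk (by omega), Nat.sub_sub_self hk]

theorem coverTile_eq_of_center_mem {u : TileIndex n} {c : Cell n}
    (h : cellCenter n c.1 c.2 ∈ tileOf n u) : coverTile u.1 c = u := by
  rw [center_mem_tileOf_iff] at h
  exact TileIndex.ext_nat rfl h.1 h.2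

theorem center_mem_interior_coverTile (k : Fin (n + 1)) (c : Cell n) :
    cellCenter n c.1 c.2 ∈ interior (tileOf n (coverTile k c)) := by
  have hk := Nat.lt_succ_iff.1 k.2
  refine center_mem_interior_dyadicTile hk (Nat.sub_le _ _) rfl ?_
  simp only [coverTile, Nat.sub_sub_self hk]

theorem dyadicTile_subset {i j a b i' j' a' b' : ℕ}
    (h : dyadicTile i j a b ⊆ dyadicTile i' j' a' b') : i' ≤ i ∧ j' ≤ j := by
  have key : ∀ {i a i' a' : ℕ}, Set.Icc ((a : ℝ) / 2 ^ i) (((a : ℝ) + 1) / 2 ^ i) ⊆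
      Set.Icc ((a' : ℝ) / 2 ^ i') (((a' : ℝ) + 1) / 2 ^ i') → i' ≤ i := by
    intro i a i' a' h
    rw [Set.Icc_subset_Icc_iff (by gcongr; linarith), add_div, add_div] at h
    have h' : (1 : ℝ) / 2 ^ i ≤ 1 / 2 ^ i' := by linarith
    rw [one_div_le_one_div (by positivity) (by positivity)] at h'
    exact (pow_le_pow_iff_right₀ (by norm_num)).1 h'
  have hne : ∀ i a : ℕ, (Set.Icc ((a : ℝ) / 2 ^ i) (((a : ℝ) + 1) / 2 ^ i)).Nonempty :=
    fun i a => Set.nonempty_Icc.2 (by gcongr; linarith)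
  rw [dyadicTile, dyadicTile, Set.prod_subset_prod_iff] at h
  rcases h with ⟨h1, h2⟩ | h | h
  · exact ⟨key h1, key h2⟩
  · exact absurd h (hne i a).ne_empty
  · exact absurd h (hne j b).ne_empty

theorem tileOf_injective_fst {u v : TileIndex n} (h : tileOf n u = tileOf n v) : u.1 = v.1 :=
  Fin.ext (le_antisymm (dyadicTile_subset h.ge).1 (dyadicTile_subset h.le).1)

/-- Two tiles whose union is a tile of the previous order are friends. -/
theorem isFriend_of_union {u v : TileIndex n} (hn : 1 ≤ n)
    (h : IsDyadicTile (n - 1) (tileOf n u ∪ tileOf n v)) : IsFriend u v := by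
  obtain ⟨i, j, a, b, hij, -, -, hR⟩ := h
  have hi : n - i = j + 1 := by omega
  have hj : n - j = i + 1 := by omega
  have hiff : ∀ x y : ℕ, ((x / 2 ^ (n - (u.1 : ℕ)) = u.2.1 ∧ y / 2 ^ (u.1 : ℕ) = u.2.2) ∨
      (x / 2 ^ (n - (v.1 : ℕ)) = v.2.1 ∧ y / 2 ^ (v.1 : ℕ) = v.2.2)) ↔
      x / 2 ^ (j + 1) = a ∧ y / 2 ^ (i + 1) = b := by
    intro x y
    rw [← center_mem_tileOf_iff, ← center_mem_tileOf_iff, ← Set.mem_union, hR,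
      center_mem_dyadicTile_iff (by omega) (by omega), hi, hj]
  have hshape : ∀ w : TileIndex n, tileOf n w ⊆ tileOf n u ∪ tileOf n v →
      ((w.1 : ℕ) = i ∧ (w.2.1 : ℕ) = a ∧ (w.2.2 : ℕ) / 2 = b) ∨
      ((w.1 : ℕ) = i + 1 ∧ (w.2.1 : ℕ) / 2 = a ∧ (w.2.2 : ℕ) = b) := by
    intro w hw
    rw [hR] at hw
    have hk := dyadicTile_subset hw
    have hmem : cellCenter n (w.2.1 * 2 ^ (n - (w.1 : ℕ))) (w.2.2 * 2 ^ (w.1 : ℕ)) ∈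
        tileOf n w := by
      rw [center_mem_tileOf_iff]
      simp
    have hmem' := hw hmem
    rw [center_mem_dyadicTile_iff (by omega) (by omega), hi, hj] at hmem'
    obtain hk' | hk' : (w.1 : ℕ) = i ∨ (w.1 : ℕ) = i + 1 := by omega
    · left
      simp only [hk', hi] at hmem'
      rw [pow_succ 2 i, ← Nat.div_div_eq_div_mul] at hmem'
      simpa [hk'] using hmem'
    · right
      have : n - (i + 1) = j := by omega
      simp only [hk', this] at hmem'
      rw [pow_succ 2 j, ← Nat.div_div_eq_div_mul] at hmem'
      simpa [hk'] using hmem'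
  have hq : ∀ ε δ : ℕ, ε < 2 → δ < 2 →
      (((u.1 : ℕ) = i ∧ (u.2.2 : ℕ) = 2 * b + δ) ∨
        ((u.1 : ℕ) = i + 1 ∧ (u.2.1 : ℕ) = 2 * a + ε)) ∨
      (((v.1 : ℕ) = i ∧ (v.2.2 : ℕ) = 2 * b + δ) ∨
        ((v.1 : ℕ) = i + 1 ∧ (v.2.1 : ℕ) = 2 * a + ε)) := by
    intro ε δ hε hδ
    have hx : ((2 * a + ε) * 2 ^ j) / 2 ^ (j + 1) = a := by
      rw [pow_succ 2 j, ← Nat.div_div_eq_div_mul, Nat.mul_div_cancel _ (by positivity)]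
      omega
    have hy : ((2 * b + δ) * 2 ^ i) / 2 ^ (i + 1) = b := by
      rw [pow_succ 2 i, ← Nat.div_div_eq_div_mul, Nat.mul_div_cancel _ (by positivity)]
      omega
    have key : ∀ w : TileIndex n, tileOf n w ⊆ tileOf n u ∪ tileOf n v →
        (2 * a + ε) * 2 ^ j / 2 ^ (n - (w.1 : ℕ)) = w.2.1 ∧
          (2 * b + δ) * 2 ^ i / 2 ^ (w.1 : ℕ) = w.2.2 →
        (((w.1 : ℕ) = i ∧ (w.2.2 : ℕ) = 2 * b + δ) ∨
          ((w.1 : ℕ) = i + 1 ∧ (w.2.1 : ℕ) = 2 * a + ε)) := by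
      intro w hw hcov
      rcases hshape w hw with h | h
      · left
        have := hcov.2
        simp only [h.1] at this
        rw [Nat.mul_div_cancel _ (by positivity)] at this
        exact ⟨h.1, this.symm⟩
      · right
        have := hcov.1
        have hj' : n - (i + 1) = j := by omega
        simp only [h.1, hj'] at this
        rw [Nat.mul_div_cancel _ (by positivity)] at this
        exact ⟨h.1, this.symm⟩
    exact ((hiff _ _).2 ⟨hx, hy⟩).imp (key u Set.subset_union_left) (key v Set.subset_union_right)
  have hu := hshape u Set.subset_union_left
  have hv := hshape v Set.subset_union_right
  have q00 := hq 0 0 (by norm_num) (by norm_num)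
  have q01 := hq 0 1 (by norm_num) (by norm_num)
  have q10 := hq 1 0 (by norm_num) (by norm_num)
  have q11 := hq 1 1 (by norm_num) (by norm_num)
  have hfst : (u.1 : ℕ) = v.1 := by omega
  refine ⟨Fin.ext hfst, ?_, by omega⟩
  rintro rfl
  omega

theorem badSquareExists_of_isBadCell (hn : 1 ≤ n) {S : Finset (TileIndex n)} {c : Cell n}
    (h : IsBadCell c S) : BadSquareExists n S := by
  refine ⟨c.1, c.2, c.1.2, c.2.2, fun u hu hsub v hv huv => ?_⟩
  have hc : cellCenter n c.1 c.2 ∈ smallSquare n c.1 c.2 := by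
    have : smallSquare n c.1 c.2 = dyadicTile n n c.1 c.2 := rfl
    rw [this, center_mem_dyadicTile_iff le_rfl le_rfl]
    simp
  have e := coverTile_eq_of_center_mem (hsub hc)
  exact h u.1 (e.symm ▸ hu) v hv (e.symm ▸ isFriend_of_union hn huv)

theorem cellCenter_mem_unitSquare (c : Cell n) : cellCenter n c.1 c.2 ∈ unitSquare := by
  have : unitSquare = dyadicTile 0 0 0 0 := by simp [unitSquare, dyadicTile]
  rw [this, center_mem_dyadicTile_iff (Nat.zero_le _) (Nat.zero_le _)]
  simp

/-- A bad cell prevents tiling. -/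
theorem not_isBadCell_of_tileable (hn : 1 ≤ n) {S : Finset (TileIndex n)}
    (h : TileableSquare n S) (c : Cell n) : ¬ IsBadCell c S := by
  obtain ⟨F, hFS, -, hU, hdisj⟩ := h
  have hcov : ∀ c, ∃ k, coverTile k c ∈ {u : TileIndex n | u ∈ S ∧ tileOf n u ∈ F} := by
    intro c
    have hc := cellCenter_mem_unitSquare c
    rw [← hU] at hc
    obtain ⟨t, htF, hct⟩ := hc
    obtain ⟨u, huS, rfl⟩ := hFS t htF
    exact ⟨u.1, by rw [coverTile_eq_of_center_mem hct]; exact ⟨huS, htF⟩⟩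
  obtain ⟨k, hk⟩ := hcov c
  obtain ⟨v, hv, hkv⟩ := exists_friend_of_exact_cover hn hcov (fun d k k' hd hd' => by
    by_contra hne
    have hne' : tileOf n (coverTile k d) ≠ tileOf n (coverTile k' d) :=
      fun h => hne (tileOf_injective_fst h)
    have h0 := hdisj hd.2 hd'.2 hne'
    have h1 : cellCenter n d.1 d.2 ∈ interior (tileOf n (coverTile k d)) ∩
        interior (tileOf n (coverTile k' d)) :=
      ⟨center_mem_interior_coverTile k d, center_mem_interior_coverTile k' d⟩
    rw [h0] at h1
    exact h1) hk
  exact fun hbad => hbad k hk.1 v hv.1 hkv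

/-- The square can be tiled when every tile is available. -/
theorem tileableSquare_univ : TileableSquare n Finset.univ := by
  have hp : (0 : ℝ) < 2 ^ n := by positivity
  refine ⟨{t | ∃ a < 2 ^ n, t = dyadicTile n 0 a 0}, ?_, ?_, ?_, ?_⟩
  · rintro t ⟨a, ha, rfl⟩
    exact ⟨⟨Fin.last n, ⟨a, ha⟩, ⟨0, by positivity⟩⟩, Finset.mem_univ _, by simp [tileOf]⟩
  · rintro t ⟨a, ha, rfl⟩
    exact ⟨n, 0, a, 0, rfl, ha, by simp, rfl⟩
  · ext ⟨x, y⟩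
    simp only [Set.mem_sUnion, Set.mem_ofPred_eq, unitSquare, Set.mem_prod, Set.mem_Icc]
    constructor
    · rintro ⟨t, ⟨a, ha, rfl⟩, ⟨hx1, hx2⟩, hy⟩
      have ha' : (a : ℝ) + 1 ≤ 2 ^ n := by exact_mod_cast ha
      refine ⟨⟨le_trans (by positivity) hx1, hx2.trans ?_⟩, by simpa using hy⟩
      rwa [div_le_one hp]
    · rintro ⟨⟨hx0, hx1⟩, hy⟩
      refine ⟨_, ⟨min ⌊x * 2 ^ n⌋₊ (2 ^ n - 1), ?_, rfl⟩, ?_, by simpa using hy⟩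
      · have : 0 < 2 ^ n := by positivity
        omega
      · simp only [Set.mem_Icc]
        rw [div_le_iff₀ hp, le_div_iff₀ hp]
        have hfl : (⌊x * 2 ^ n⌋₊ : ℝ) ≤ x * 2 ^ n := Nat.floor_le (by positivity)
        constructor
        · refine le_trans ?_ hfl
          exact_mod_cast min_le_left _ _
        · rcases min_cases ⌊x * 2 ^ n⌋₊ (2 ^ n - 1) with ⟨h, -⟩ | ⟨h, -⟩
          · rw [h]
            exact (Nat.lt_floor_add_one _).le
          · rw [h, Nat.cast_sub Nat.one_le_two_pow]
            push_cast
            nlinarith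
  · rintro s ⟨a, -, rfl⟩ t ⟨b, -, rfl⟩ hne
    simp only [dyadicTile, interior_prod_eq, interior_Icc, Set.prod_inter_prod, Set.Ioo_inter_Ioo]
    rw [Set.prod_eq_empty_iff]
    left
    rw [Set.Ioo_eq_empty_iff, not_lt]
    rcases lt_trichotomy a b with h | h | h
    · refine (inf_le_left).trans (le_trans ?_ le_sup_right)
      have : (a : ℝ) + 1 ≤ b := by exact_mod_cast h
      gcongr
    · exact absurd (by rw [h]) hne
    · refine (inf_le_right).trans (le_trans ?_ le_sup_left)
      have : (b : ℝ) + 1 ≤ a := by exact_mod_cast h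
      gcongr

end Tiles

section BadCells

variable {n : ℕ} {p : ℝ}

/-- The tiles of shape `k` whose position agrees, after halving both coordinates, with that of
the tile covering `c`; it contains this tile and all its friends. -/
def block (k : Fin (n + 1)) (c : Cell n) : Finset (TileIndex n) :=
  {v | v.1 = k ∧ (v.2.1 : ℕ) / 2 = c.1 / 2 ^ (n - (k : ℕ)) / 2 ∧
    (v.2.2 : ℕ) / 2 = c.2 / 2 ^ (k : ℕ) / 2}

/-- The cells `c` and `d` have the same block of shape `k`. -/
def SameBlock (k : Fin (n + 1)) (c d : Cell n) : Prop :=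
  (c.1 : ℕ) / 2 ^ (n - (k : ℕ)) / 2 = d.1 / 2 ^ (n - (k : ℕ)) / 2 ∧
    (c.2 : ℕ) / 2 ^ (k : ℕ) / 2 = d.2 / 2 ^ (k : ℕ) / 2

instance (k : Fin (n + 1)) (c d : Cell n) : Decidable (SameBlock k c d) :=
  inferInstanceAs (Decidable (_ ∧ _))

open Classical in
/-- Indicator of the event that the tile of shape `k` covering `c` is not available together
with one of its friends. -/
def shapeIndicator (k : Fin (n + 1)) (c : Cell n) (S : Finset (TileIndex n)) : ℝ :=
  if coverTile k c ∈ S ∧ ¬ Disjoint S (friends (coverTile k c)) then 0 else 1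

/-- Indicator of the event that `c` is bad. -/
def badIndicator (c : Cell n) (S : Finset (TileIndex n)) : ℝ := ∏ k, shapeIndicator k c S

theorem shapeIndicator_nonneg (k : Fin (n + 1)) (c : Cell n) (S : Finset (TileIndex n)) :
    0 ≤ shapeIndicator k c S := by
  unfold shapeIndicator
  split_ifs <;> norm_num

theorem shapeIndicator_le_one (k : Fin (n + 1)) (c : Cell n) (S : Finset (TileIndex n)) :
    shapeIndicator k c S ≤ 1 := by
  unfold shapeIndicator
  split_ifs <;> norm_num

theorem badIndicator_eq_zero {c : Cell n} {S : Finset (TileIndex n)} (h : ¬ IsBadCell c S) :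
    badIndicator c S = 0 := by
  unfold IsBadCell at h
  push Not at h
  obtain ⟨k, hk, v, hv, hf⟩ := h
  refine Finset.prod_eq_zero (Finset.mem_univ k) ?_
  rw [shapeIndicator, if_pos]
  exact ⟨hk, Finset.not_disjoint_iff.2 ⟨v, hv, mem_friends.2 hf⟩⟩

theorem coverTile_mem_block (k : Fin (n + 1)) (c : Cell n) : coverTile k c ∈ block k c := by
  simp [block, coverTile]

theorem friends_subset_block (k : Fin (n + 1)) (c : Cell n) :
    friends (coverTile k c) ⊆ block k c := by
  intro v hv
  obtain ⟨h1, -, h2⟩ := mem_friends.1 hv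
  simp only [block, Finset.mem_filter, Finset.mem_univ, true_and]
  simp only [coverTile] at h1 h2
  refine ⟨h1.symm, ?_, ?_⟩ <;> omega

theorem determinedBy_shapeIndicator (k : Fin (n + 1)) (c : Cell n) :
    DeterminedBy (shapeIndicator k c) (block k c) := by
  intro S
  have h : Disjoint (S ∩ block k c) (friends (coverTile k c)) ↔
      Disjoint S (friends (coverTile k c)) := by
    rw [Finset.disjoint_iff_inter_eq_empty, Finset.disjoint_iff_inter_eq_empty,
      Finset.inter_assoc, Finset.inter_eq_right.2 (friends_subset_block k c)]
  simp only [shapeIndicator, h, Finset.mem_inter, coverTile_mem_block, and_true]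

theorem disjoint_block_of_not_sameBlock {k : Fin (n + 1)} {c d : Cell n}
    (h : ¬ SameBlock k c d) : Disjoint (block k c) (block k d) := by
  rw [Finset.disjoint_left]
  intro v hc hd
  simp only [block, Finset.mem_filter, Finset.mem_univ, true_and] at hc hd
  exact h ⟨hc.2.1.symm.trans hd.2.1, hc.2.2.symm.trans hd.2.2⟩

theorem block_subset (k : Fin (n + 1)) (c : Cell n) :
    block k c ⊆ ({v | v.1 = k} : Finset (TileIndex n)) := by
  intro v hv
  simp only [block, Finset.mem_filter] at hv ⊢
  exact ⟨hv.1, hv.2.1⟩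

theorem pairwiseDisjoint_shape (s : Set (Fin (n + 1))) :
    s.PairwiseDisjoint fun k => ({v | v.1 = k} : Finset (TileIndex n)) := by
  intro k _ k' _ hne
  simp only [Function.onFun]
  rw [Finset.disjoint_left]
  intro v hv hv'
  simp only [Finset.mem_filter, Finset.mem_univ, true_and] at hv hv'
  exact hne (hv.symm.trans hv')

theorem le_bernoulliExp_shapeIndicator (hp0 : 0 ≤ p) (hp1 : p ≤ 1) (k : Fin (n + 1))
    (c : Cell n) : 1 - p + p * (1 - p) ^ 2 ≤ bernoulliExp p (shapeIndicator k c) := by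
  have h := bernoulliExp_isolated_ge hp0 hp1 (notMem_friends (coverTile k c)) (card_friends_le _)
  unfold shapeIndicator
  convert h

theorem bernoulliExp_badIndicator (c : Cell n) :
    bernoulliExp p (badIndicator c) = ∏ k, bernoulliExp p (shapeIndicator k c) :=
  bernoulliExp_prod _ (fun k _ => (determinedBy_shapeIndicator k c).mono (block_subset k c))
    (pairwiseDisjoint_shape _)

theorem bernoulliExp_badIndicator_mul (c d : Cell n) :
    bernoulliExp p (fun S => badIndicator c S * badIndicator d S) =
      ∏ k, bernoulliExp p (fun S => shapeIndicator k c S * shapeIndicator k d S) := by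
  simp only [badIndicator, ← Finset.prod_mul_distrib]
  exact bernoulliExp_prod (f := fun k S => shapeIndicator k c S * shapeIndicator k d S) _
    (fun k _ => ((determinedBy_shapeIndicator k c).mono (block_subset k c)).mul
      ((determinedBy_shapeIndicator k d).mono (block_subset k d)))
    (pairwiseDisjoint_shape _)

theorem bernoulliExp_shapeIndicator_mul_le (hp0 : 0 ≤ p) (hp1 : p ≤ 1) {r : ℝ} (hr0 : 0 < r)
    (hr : r ≤ 1 - p + p * (1 - p) ^ 2) (k : Fin (n + 1)) (c d : Cell n) :
    bernoulliExp p (fun S => shapeIndicator k c S * shapeIndicator k d S) ≤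
      bernoulliExp p (shapeIndicator k c) * bernoulliExp p (shapeIndicator k d) *
        (if SameBlock k c d then r⁻¹ else 1) := by
  have hc := hr.trans (le_bernoulliExp_shapeIndicator hp0 hp1 k c)
  have hd := hr.trans (le_bernoulliExp_shapeIndicator hp0 hp1 k d)
  split_ifs with h
  · calc bernoulliExp p (fun S => shapeIndicator k c S * shapeIndicator k d S)
        ≤ bernoulliExp p (shapeIndicator k c) := bernoulliExp_mono hp0 hp1 fun S =>
          mul_le_of_le_one_right (shapeIndicator_nonneg k c S) (shapeIndicator_le_one k d S)
      _ ≤ _ := by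
        rw [mul_assoc]
        refine le_mul_of_one_le_right (hr0.le.trans hc) ?_
        rwa [← div_eq_mul_inv, one_le_div hr0]
  · rw [mul_one]
    exact (bernoulliExp_mul (determinedBy_shapeIndicator k c) (determinedBy_shapeIndicator k d)
      (disjoint_block_of_not_sameBlock h)).le

/-- An upper bound for the normalised covariance of the events that `c` and `d` are bad. -/
def overlapWeight (r : ℝ) (c d : Cell n) : ℝ :=
  ∑ i : Fin (n + 1), ∑ j : Fin (n + 1),
    if i ≤ j ∧ SameBlock i c d ∧ SameBlock j c d then r⁻¹ ^ ((j : ℕ) - i + 1) else 0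

theorem pow_card_sameBlock_le {r : ℝ} (hr0 : 0 < r) (hr1 : r ≤ 1) (c d : Cell n) :
    ∏ k : Fin (n + 1), (if SameBlock k c d then r⁻¹ else 1) ≤ 1 + overlapWeight r c d := by
  rw [Finset.prod_ite, Finset.prod_const, Finset.prod_const_one, mul_one]
  set D : Finset (Fin (n + 1)) := {k | SameBlock k c d}
  have hterm : ∀ i j : Fin (n + 1), 0 ≤
      if i ≤ j ∧ SameBlock i c d ∧ SameBlock j c d then r⁻¹ ^ ((j : ℕ) - i + 1) else 0 := by
    intro i j
    split_ifs <;> positivity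
  rcases D.eq_empty_or_nonempty with h | h
  · have hw : 0 ≤ overlapWeight r c d :=
      Finset.sum_nonneg fun i _ => Finset.sum_nonneg fun j _ => hterm i j
    simpa [h] using hw
  · have hmin := D.min'_mem h
    have hmax := D.max'_mem h
    have hle := D.min'_le _ hmax
    set i := D.min' h
    set j := D.max' h
    have hcard : D.card ≤ (j : ℕ) - i + 1 := by
      have hsub : D ⊆ Finset.Icc i j := fun k hk =>
        Finset.mem_Icc.2 ⟨D.min'_le k hk, D.le_max' k hk⟩
      have := Finset.card_le_card hsub
      rw [Fin.card_Icc] at this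
      have : (i : ℕ) ≤ j := hle
      omega
    calc r⁻¹ ^ D.card ≤ r⁻¹ ^ ((j : ℕ) - i + 1) :=
          pow_le_pow_right₀ ((one_le_inv₀ hr0).2 hr1) hcard
      _ = if i ≤ j ∧ SameBlock i c d ∧ SameBlock j c d then r⁻¹ ^ ((j : ℕ) - i + 1) else 0 := by
          rw [if_pos]
          exact ⟨hle, (Finset.mem_filter.1 hmin).2, (Finset.mem_filter.1 hmax).2⟩
      _ ≤ overlapWeight r c d :=
          (Finset.single_le_sum (fun j _ => hterm i j) (Finset.mem_univ j)).trans
            (Finset.single_le_sum (f := fun i : Fin (n + 1) => ∑ j : Fin (n + 1),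
              if i ≤ j ∧ SameBlock i c d ∧ SameBlock j c d then r⁻¹ ^ ((j : ℕ) - i + 1) else 0)
              (fun i _ => Finset.sum_nonneg fun j _ => hterm i j) (Finset.mem_univ i))
      _ ≤ 1 + overlapWeight r c d := by linarith

theorem bernoulliExp_badIndicator_mul_le (hp0 : 0 ≤ p) (hp1 : p ≤ 1) {r : ℝ} (hr0 : 0 < r)
    (hr1 : r ≤ 1) (hr : r ≤ 1 - p + p * (1 - p) ^ 2) (c d : Cell n) :
    bernoulliExp p (fun S => badIndicator c S * badIndicator d S) ≤
      bernoulliExp p (badIndicator c) * bernoulliExp p (badIndicator d) *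
        (1 + overlapWeight r c d) := by
  have hpos : ∀ c : Cell n, 0 ≤ bernoulliExp p (badIndicator c) := fun c => by
    rw [bernoulliExp_badIndicator]
    exact Finset.prod_nonneg fun k _ =>
      hr0.le.trans (hr.trans (le_bernoulliExp_shapeIndicator hp0 hp1 k c))
  refine le_trans ?_ (mul_le_mul_of_nonneg_left (pow_card_sameBlock_le hr0 hr1 c d)
    (mul_nonneg (hpos c) (hpos d)))
  rw [bernoulliExp_badIndicator_mul, bernoulliExp_badIndicator, bernoulliExp_badIndicator,
    ← Finset.prod_mul_distrib, ← Finset.prod_mul_distrib]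
  refine Finset.prod_le_prod (fun k _ => ?_) fun k _ =>
    bernoulliExp_shapeIndicator_mul_le hp0 hp1 hr0 hr k c d
  rw [← bernoulliExp_const (α := TileIndex n) (p := p) 0]
  exact bernoulliExp_mono hp0 hp1 fun S =>
    mul_nonneg (shapeIndicator_nonneg k c S) (shapeIndicator_nonneg k d S)

theorem card_filter_div_eq_le (N M t : ℕ) (hM : 0 < M) :
    (Finset.univ.filter fun x : Fin N => t = (x : ℕ) / M).card ≤ M := by
  calc _ ≤ (Finset.Ico (t * M) (t * M + M)).card := by
        refine Finset.card_le_card_of_injOn (fun x => (x : ℕ)) ?_ (Fin.val_injective.injOn)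
        intro x hx
        have hx' : t = (x : ℕ) / M := by simpa using hx
        have h := (Nat.div_eq_iff hM).1 hx'.symm
        simp only [Finset.coe_Ico, Set.mem_Ico]
        omega
    _ = M := by simp

theorem card_sameBlock_le (c : Cell n) (i j : Fin (n + 1)) :
    (Finset.univ.filter fun d : Cell n => SameBlock i c d ∧ SameBlock j c d).card ≤
      2 ^ (n - (j : ℕ) + 1) * 2 ^ ((i : ℕ) + 1) := by
  have hsub : (Finset.univ.filter fun d : Cell n => SameBlock i c d ∧ SameBlock j c d) ⊆
      (Finset.univ.filter fun x : Fin (2 ^ n) =>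
        (c.1 : ℕ) / 2 ^ (n - (j : ℕ) + 1) = (x : ℕ) / 2 ^ (n - (j : ℕ) + 1)) ×ˢ
      (Finset.univ.filter fun y : Fin (2 ^ n) =>
        (c.2 : ℕ) / 2 ^ ((i : ℕ) + 1) = (y : ℕ) / 2 ^ ((i : ℕ) + 1)) := by
    intro d hd
    obtain ⟨-, hi, hj⟩ := Finset.mem_filter.1 hd
    simp only [Finset.mem_product, Finset.mem_filter, Finset.mem_univ, true_and, pow_succ,
      ← Nat.div_div_eq_div_mul]
    exact ⟨hj.1, hi.2⟩
  refine (Finset.card_le_card hsub).trans ?_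
  rw [Finset.card_product]
  exact Nat.mul_le_mul (card_filter_div_eq_le _ _ _ (by positivity))
    (card_filter_div_eq_le _ _ _ (by positivity))

theorem sum_overlapWeight_le {r : ℝ} (hr0 : 0 < r) (hr : r ≤ 1 / 2) (c : Cell n) :
    ∑ d, overlapWeight r c d ≤ (n + 1) ^ 2 * (4 * r⁻¹ * r⁻¹ ^ n) := by
  have hinv : 2 ≤ r⁻¹ := by
    rw [le_inv_comm₀ (by norm_num) hr0]
    linarith
  simp only [overlapWeight]
  rw [Finset.sum_comm]
  have key : ∀ i j : Fin (n + 1), ∑ d : Cell n,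
      (if i ≤ j ∧ SameBlock i c d ∧ SameBlock j c d then r⁻¹ ^ ((j : ℕ) - i + 1) else 0) ≤
      4 * r⁻¹ * r⁻¹ ^ n := by
    intro i j
    by_cases hij : i ≤ j
    · simp only [hij, true_and]
      rw [← Finset.sum_filter, Finset.sum_const, nsmul_eq_mul]
      obtain ⟨e, he⟩ := Nat.exists_eq_add_of_le (show (i : ℕ) ≤ j from hij)
      obtain ⟨m, hm⟩ := Nat.exists_eq_add_of_le (Nat.lt_succ_iff.1 j.2)
      have hcard : ((Finset.univ.filter fun d : Cell n =>
          SameBlock i c d ∧ SameBlock j c d).card : ℝ) ≤ 4 * 2 ^ (n - e) := by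
        have h := card_sameBlock_le c i j
        have h' : 2 ^ (n - (j : ℕ) + 1) * 2 ^ ((i : ℕ) + 1) = 4 * 2 ^ (n - e) := by
          have h1 : n - (j : ℕ) = m := by omega
          have h2 : n - e = m + i := by omega
          rw [h1, h2]
          ring
        rw [h'] at h
        exact_mod_cast h
      have he' : (j : ℕ) - i = e := by omega
      rw [he']
      have hn : r⁻¹ ^ n = r⁻¹ ^ (n - e) * r⁻¹ ^ e := by
        rw [← pow_add]
        congr 1
        omega
      calc _ ≤ 4 * 2 ^ (n - e) * r⁻¹ ^ (e + 1) := by gcongr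
        _ ≤ 4 * r⁻¹ ^ (n - e) * r⁻¹ ^ (e + 1) := by gcongr
        _ = 4 * r⁻¹ * r⁻¹ ^ n := by rw [hn]; ring
    · simp only [hij, false_and, if_false, Finset.sum_const_zero]
      positivity
  calc _ ≤ ∑ _i : Fin (n + 1), ∑ _j : Fin (n + 1), 4 * r⁻¹ * r⁻¹ ^ n := by
        refine Finset.sum_le_sum fun i _ => ?_
        rw [Finset.sum_comm]
        exact Finset.sum_le_sum fun j _ => key i j
    _ = _ := by
        simp
        ring

open Classical in
/-- Second moment bound for the probability that there is no bad cell. -/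
theorem bernoulliExp_no_badCell_le (hp0 : 0 ≤ p) (hp1 : p ≤ 1) {r : ℝ} (hr0 : 0 < r)
    (hr1 : r ≤ 1 / 2) (hr : r ≤ 1 - p + p * (1 - p) ^ 2) :
    bernoulliExp p (fun S : Finset (TileIndex n) => if ∃ c, IsBadCell c S then (0 : ℝ) else 1) ≤
      4 * r⁻¹ * ((n + 1) ^ 2 * ((4 * r)⁻¹) ^ n) := by
  set P : Cell n → ℝ := fun c => bernoulliExp p (badIndicator c) with hP
  have hPpos : ∀ c, 0 < P c := fun c => by
    simp only [hP, bernoulliExp_badIndicator]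
    exact Finset.prod_pos fun k _ =>
      hr0.trans_le (hr.trans (le_bernoulliExp_shapeIndicator hp0 hp1 k c))
  set N : ℝ := 4 ^ n with hN
  have hN0 : 0 < N := by positivity
  have hcard : ∑ _c : Cell n, (1 : ℝ) = N := by
    simp [hN, ← mul_pow]
  set Y : Finset (TileIndex n) → ℝ := fun S => ∑ c, (P c)⁻¹ * badIndicator c S with hY
  have hEY : bernoulliExp p Y = N := by
    simp only [hY]
    rw [bernoulliExp_sum, ← hcard]
    refine Finset.sum_congr rfl fun c _ => ?_
    rw [bernoulliExp_const_mul]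
    exact inv_mul_cancel₀ (hPpos c).ne'
  have hEY2 : bernoulliExp p (fun S => Y S * Y S) ≤
      N ^ 2 + N * ((n + 1) ^ 2 * (4 * r⁻¹ * r⁻¹ ^ n)) := by
    have hexp : (fun S => Y S * Y S) = fun S => ∑ c, ∑ d,
        ((P c)⁻¹ * (P d)⁻¹) * (badIndicator c S * badIndicator d S) := by
      funext S
      simp only [hY, Finset.sum_mul_sum]
      exact Finset.sum_congr rfl fun c _ => Finset.sum_congr rfl fun d _ => by ring
    rw [hexp, bernoulliExp_sum]
    calc _ ≤ ∑ c : Cell n, (N + (n + 1) ^ 2 * (4 * r⁻¹ * r⁻¹ ^ n)) := by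
          refine Finset.sum_le_sum fun c _ => ?_
          rw [bernoulliExp_sum]
          calc _ ≤ ∑ d, (1 + overlapWeight r c d) := by
                refine Finset.sum_le_sum fun d _ => ?_
                rw [bernoulliExp_const_mul, ← mul_inv, inv_mul_le_iff₀
                  (mul_pos (hPpos c) (hPpos d))]
                exact bernoulliExp_badIndicator_mul_le hp0 hp1 hr0 (by linarith) hr c d
            _ ≤ _ := by
                rw [Finset.sum_add_distrib, hcard]
                gcongr
                exact sum_overlapWeight_le hr0 hr1 c
      _ = (∑ c : Cell n, (1 : ℝ)) * (N + (n + 1) ^ 2 * (4 * r⁻¹ * r⁻¹ ^ n)) := by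
          rw [Finset.sum_mul]
          simp
      _ = _ := by
          rw [hcard]
          ring
  have hvar : bernoulliExp p (fun S => (Y S * Y S + (-2 * N) * Y S) + N ^ 2) ≤
      N * ((n + 1) ^ 2 * (4 * r⁻¹ * r⁻¹ ^ n)) := by
    rw [bernoulliExp_add, bernoulliExp_add, bernoulliExp_const_mul, bernoulliExp_const, hEY]
    linarith
  have hcheb : N ^ 2 * bernoulliExp p (fun S : Finset (TileIndex n) =>
      if ∃ c, IsBadCell c S then (0 : ℝ) else 1) ≤ N * ((n + 1) ^ 2 * (4 * r⁻¹ * r⁻¹ ^ n)) := by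
    rw [← bernoulliExp_const_mul]
    refine le_trans (bernoulliExp_mono hp0 hp1 fun S => ?_) hvar
    split_ifs with h
    · nlinarith [sq_nonneg (Y S - N)]
    · push Not at h
      have hY0 : Y S = 0 :=
        Finset.sum_eq_zero fun c _ => by rw [badIndicator_eq_zero (h c), mul_zero]
      rw [hY0]
      linarith
  have hfin : N * ((n + 1) ^ 2 * (4 * r⁻¹ * r⁻¹ ^ n)) =
      N ^ 2 * (4 * r⁻¹ * ((n + 1) ^ 2 * ((4 * r)⁻¹) ^ n)) := by
    have : ((4 * r)⁻¹) ^ n = N⁻¹ * r⁻¹ ^ n := by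
      rw [mul_inv, mul_pow, inv_pow]
    rw [this]
    field_simp
  rw [hfin] at hcheb
  exact le_of_mul_le_mul_left hcheb (by positivity)

end BadCells

section Limits

variable {n : ℕ} {p : ℝ}

theorem card_tileIndex : Fintype.card (TileIndex n) = (n + 1) * 2 ^ n := by
  rw [Fintype.card_sigma, Finset.sum_congr rfl (g := fun _ => 2 ^ n)]
  · simp
  · intro i _
    rw [Fintype.card_prod, Fintype.card_fin, Fintype.card_fin, ← pow_add,
      Nat.add_sub_cancel' (Nat.lt_succ_iff.1 i.2)]

open Classical in
theorem Pr_eq_bernoulliExp (E : Finset (TileIndex n) → Prop) :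
    Pr n p E = bernoulliExp p (fun S => if E S then 1 else 0) := by
  simp only [Pr, bernoulliExp, card_tileIndex, mul_ite, mul_one, mul_zero]

theorem Pr_nonneg (hp0 : 0 ≤ p) (hp1 : p ≤ 1) (E : Finset (TileIndex n) → Prop) :
    0 ≤ Pr n p E := by
  rw [Pr_eq_bernoulliExp]
  refine (bernoulliExp_const (α := TileIndex n) (p := p) 0).ge.trans
    (bernoulliExp_mono hp0 hp1 fun S => ?_)
  split_ifs <;> norm_num

theorem Pr_mono (hp0 : 0 ≤ p) (hp1 : p ≤ 1) {E F : Finset (TileIndex n) → Prop}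
    (h : ∀ S, E S → F S) : Pr n p E ≤ Pr n p F := by
  rw [Pr_eq_bernoulliExp, Pr_eq_bernoulliExp]
  refine bernoulliExp_mono hp0 hp1 fun S => ?_
  have := h S
  split_ifs <;> first | tauto | norm_num

theorem Pr_add_Pr_not (E : Finset (TileIndex n) → Prop) :
    Pr n p E + Pr n p (fun S => ¬ E S) = 1 := by
  rw [Pr_eq_bernoulliExp, Pr_eq_bernoulliExp, ← bernoulliExp_add]
  refine Eq.trans ?_ (bernoulliExp_const (α := TileIndex n) (p := p) 1)
  congr 1
  funext S
  split_ifs <;> norm_num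

theorem tendsto_Pr_no_badCell (hp0 : 0 ≤ p) (hp1 : p ≤ 1)
    (hq : 1 / 4 < 1 - p + p * (1 - p) ^ 2) :
    Tendsto (fun n => Pr n p fun S => ¬ ∃ c, IsBadCell c S) atTop (𝓝 0) := by
  set r : ℝ := min (1 - p + p * (1 - p) ^ 2) (1 / 2)
  have hr : 1 / 4 < r := lt_min hq (by norm_num)
  have hr0 : 0 < r := by linarith
  have hs : |(4 * r)⁻¹| < 1 := by
    rw [abs_of_pos (by positivity)]
    exact inv_lt_one_of_one_lt₀ (by linarith)
  have hlim : Tendsto (fun n : ℕ => 4 * r⁻¹ * (((n : ℝ) + 1) ^ 2 * ((4 * r)⁻¹) ^ n))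
      atTop (𝓝 0) := by
    have h := ((tendsto_pow_const_mul_const_pow_of_abs_lt_one 2 hs).comp
      (tendsto_add_atTop_nat 1)).const_mul (4 * r⁻¹ * (4 * r))
    rw [mul_zero] at h
    refine h.congr fun n => ?_
    simp only [Function.comp, Nat.cast_add, Nat.cast_one, pow_succ]
    field_simp
  refine squeeze_zero (fun n => Pr_nonneg hp0 hp1 _) (fun n => ?_) hlim
  refine le_of_eq_of_le ?_
    (bernoulliExp_no_badCell_le hp0 hp1 hr0 (min_le_right _ _) (min_le_left _ _))
  rw [Pr_eq_bernoulliExp]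
  congr 1
  funext S
  by_cases h : ∃ c, IsBadCell c S <;> simp [h]

theorem tendsto_Pr_badSquareExists (hp0 : 0 ≤ p) (hp1 : p ≤ 1)
    (hq : 1 / 4 < 1 - p + p * (1 - p) ^ 2) :
    Tendsto (fun n => Pr n p (BadSquareExists n)) atTop (𝓝 1) := by
  have h := (tendsto_Pr_no_badCell hp0 hp1 hq).const_sub 1
  rw [sub_zero] at h
  refine tendsto_of_tendsto_of_tendsto_of_le_of_le' h tendsto_const_nhds ?_ ?_
  · filter_upwards [eventually_ge_atTop 1] with n hn
    have h1 := Pr_add_Pr_not (p := p) fun S : Finset (TileIndex n) => ∃ c, IsBadCell c S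
    have h2 := Pr_mono hp0 hp1 (E := fun S : Finset (TileIndex n) => ∃ c, IsBadCell c S)
      (F := BadSquareExists n) fun S ⟨_, hc⟩ => badSquareExists_of_isBadCell hn hc
    linarith
  · filter_upwards with n
    have h1 := Pr_add_Pr_not (p := p) (BadSquareExists n)
    have h2 := Pr_nonneg hp0 hp1 fun S => ¬ BadSquareExists n S
    linarith

theorem tendsto_T_zero (hp0 : 0 ≤ p) (hp1 : p ≤ 1)
    (hq : 1 / 4 < 1 - p + p * (1 - p) ^ 2) :
    Tendsto (fun n => T n p) atTop (𝓝 0) := by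
  refine squeeze_zero' (.of_forall fun n => Pr_nonneg hp0 hp1 _) ?_
    (tendsto_Pr_no_badCell hp0 hp1 hq)
  filter_upwards [eventually_ge_atTop 1] with n hn
  exact Pr_mono hp0 hp1 fun S hS ⟨c, hc⟩ => not_isBadCell_of_tileable hn hS c hc

theorem T_one (n : ℕ) : T n 1 = 1 := by
  rw [T, Pr, Finset.sum_eq_single Finset.univ]
  · rw [if_pos tileableSquare_univ, Finset.card_univ, card_tileIndex]
    simp
  · intro S _ hS
    have hlt : S.card < (n + 1) * 2 ^ n := by
      rw [← card_tileIndex]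
      exact (Finset.card_lt_iff_ne_univ S).2 hS
    simp [Nat.sub_ne_zero_of_lt hlt]
  · simp

theorem le_pc : 0.785996 ≤ pc := by
  refine le_csInf ⟨1, by simp, by simp [T_one]⟩ ?_
  rintro p ⟨⟨hp0, hp1⟩, hp⟩
  by_contra! hlt
  have hc : (1 / 4 : ℝ) < 1 - 0.785996 + 0.785996 * (1 - 0.785996) ^ 2 := by norm_num
  have hdec : 0 ≤ (0.785996 - p) * (2 * (p + 0.785996) - (p ^ 2 + p * 0.785996 + 0.785996 ^ 2)) :=
    mul_nonneg (by linarith) (by nlinarith)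
  have hq : 1 / 4 < 1 - p + p * (1 - p) ^ 2 := by
    refine hc.trans_le ?_
    linarith
  exact zero_ne_one (tendsto_nhds_unique (tendsto_T_zero hp0 hp1 hq) hp)

end Limits

/-- if `0 < p < 1` and `1 - p + p(1-p)² > 1/4`, then with probability tending
to `1` there is a bad square, hence `T_n(p) → 0`; consequently `p_c ≥ 0.785996`. -/
theorem bad_squares :
    (∀ p : ℝ, 0 < p → p < 1 → 1 - p + p * (1 - p) ^ 2 > 1 / 4 →
      Tendsto (fun n => Pr n p (BadSquareExists n)) atTop (𝓝 1) ∧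
      Tendsto (fun n => T n p) atTop (𝓝 0)) ∧
    0.785996 ≤ pc := by
  exact ⟨fun p hp0 hp1 hq => ⟨tendsto_Pr_badSquareExists hp0.le hp1.le hq,
    tendsto_T_zero hp0.le hp1.le hq⟩, le_pc⟩

end
end

section
/- Every successor of a chain of order-k dyadic tiles can be uniquely expressed as a union of pairwise separate chains of order k+1. Moreover, if the chain has b bonds, then every successor has exactly b+1 bonds in total, and for each r = 0, 1, …, b the number of successors whose decomposition consists of exactly r+1 pairwise separate chains is 4·C(b, r). -/
open Set Filter Topology

noncomputable section

/-- Two order-`k` tiles are adjacent if their intersection is an order-`(k+1)` tile. -/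
def AdjacentTiles (k : ℕ) (s t : Set (ℝ × ℝ)) : Prop :=
  IsDyadicTile (k + 1) (s ∩ t)

/-- `C` is a chain of order-`k` tiles: the set of all order-`k` tiles containing `s ∩ t`,
for some order-`k` tiles `s`, `t` with intersecting interiors. -/
def IsChainOf (k : ℕ) (C : Set (Set (ℝ × ℝ))) : Prop :=
  ∃ s t : Set (ℝ × ℝ), IsDyadicTile k s ∧ IsDyadicTile k t ∧
    (interior s ∩ interior t).Nonempty ∧
    C = {u | IsDyadicTile k u ∧ s ∩ t ⊆ u}

/-- The number of bonds of a set of order-`k` tiles: the number of unordered pairs of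
adjacent tiles in it. -/
noncomputable def bondCount (k : ℕ) (S : Set (Set (ℝ × ℝ))) : ℕ :=
  {P : Set (ℝ × ℝ) × Set (ℝ × ℝ) | P.1 ∈ S ∧ P.2 ∈ S ∧ AdjacentTiles k P.1 P.2}.ncard / 2

/-- `c` is one of the two horizontal children of the tile `t` (obtained by a horizontal cut). -/
def IsHorizChild (c t : Set (ℝ × ℝ)) : Prop :=
  ∃ i j a b : ℕ, a < 2 ^ i ∧ b < 2 ^ j ∧ t = dyadicTile i j a b ∧
    (c = dyadicTile i (j + 1) a (2 * b) ∨ c = dyadicTile i (j + 1) a (2 * b + 1))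

/-- `c` is one of the two vertical children of the tile `t` (obtained by a vertical cut). -/
def IsVertChild (c t : Set (ℝ × ℝ)) : Prop :=
  ∃ i j a b : ℕ, a < 2 ^ i ∧ b < 2 ^ j ∧ t = dyadicTile i j a b ∧
    (c = dyadicTile (i + 1) j (2 * a) b ∨ c = dyadicTile (i + 1) j (2 * a + 1) b)

/-- `S` is a successor of the chain `C`: a set of children of tiles of `C` containing
exactly one horizontal child and exactly one vertical child of every element of `C`. -/
def IsSuccessorOf (C S : Set (Set (ℝ × ℝ))) : Prop :=
  (∀ v ∈ S, ∃ u ∈ C, IsHorizChild v u ∨ IsVertChild v u) ∧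
  (∀ u ∈ C, ∃! v, v ∈ S ∧ IsHorizChild v u) ∧
  (∀ u ∈ C, ∃! v, v ∈ S ∧ IsVertChild v u)

/-- Two chains of order-`k` tiles are separate if they are disjoint and no tile of one is
adjacent to any tile of the other. -/
def SeparateChains (k : ℕ) (C D : Set (Set (ℝ × ℝ))) : Prop :=
  Disjoint C D ∧ ∀ u ∈ C, ∀ v ∈ D, ¬ AdjacentTiles k u v

/-- The order-`n` dyadic tile of width `2⁻ⁱ`, at horizontal index `a` and vertical index `c`. -/
def levelTile (n i a c : ℕ) : Set (ℝ × ℝ) := dyadicTile i (n - i) a c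

/-- The dyadic interval `[a/2^i, (a+1)/2^i]`. -/
def dyadicIcc (i a : ℕ) : Set ℝ := Set.Icc ((a : ℝ) / 2 ^ i) (((a : ℝ) + 1) / 2 ^ i)

lemma dyadicIcc_endpoints_lt (i a : ℕ) : (a : ℝ) / 2 ^ i < ((a : ℝ) + 1) / 2 ^ i := by
  gcongr; linarith

lemma dyadicIcc_nonempty (i a : ℕ) : (dyadicIcc i a).Nonempty :=
  Set.nonempty_Icc.2 (dyadicIcc_endpoints_lt i a).le

lemma dyadicTile_eq_prod (i j a c : ℕ) : dyadicTile i j a c = dyadicIcc i a ×ˢ dyadicIcc j c := rfl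

lemma nat_div_two_pow_eq_iff {a e r : ℕ} : a / 2 ^ e = r ↔ r * 2 ^ e ≤ a ∧ a < (r + 1) * 2 ^ e := by
  have : 0 < 2 ^ e := by positivity
  rw [Nat.div_eq_iff this, add_one_mul]
  omega

lemma dyadicIcc_add_subset_iff (i e a r : ℕ) :
    dyadicIcc (i + e) a ⊆ dyadicIcc i r ↔ a / 2 ^ e = r := by
  have hi : (0 : ℝ) < 2 ^ i := by positivity
  have he : (0 : ℝ) < 2 ^ e := by positivity
  rw [dyadicIcc, dyadicIcc, Set.Icc_subset_Icc_iff (dyadicIcc_endpoints_lt _ _).le,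
    nat_div_two_pow_eq_iff, pow_add, ← Nat.succ_le_iff,
    div_le_div_iff₀ hi (by positivity), div_le_div_iff₀ (by positivity) hi,
    show (r : ℝ) * (2 ^ i * 2 ^ e) = (r * 2 ^ e) * 2 ^ i by ring,
    show ((r : ℝ) + 1) * (2 ^ i * 2 ^ e) = ((r + 1) * 2 ^ e) * 2 ^ i by ring,
    mul_le_mul_iff_left₀ hi, mul_le_mul_iff_left₀ hi]
  norm_cast

lemma dyadicIcc_subset_iff (i i' a a' : ℕ) :
    dyadicIcc i a ⊆ dyadicIcc i' a' ↔ i' ≤ i ∧ a / 2 ^ (i - i') = a' := by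
  constructor
  · intro h
    have hle : i' ≤ i := by
      have h' := (Set.Icc_subset_Icc_iff (dyadicIcc_endpoints_lt i a).le).1 h
      have h1 : (1 : ℝ) / 2 ^ i ≤ 1 / 2 ^ i' := by
        have := h'.1; have := h'.2
        simp only [add_div] at *
        linarith
      rw [one_div_le_one_div (by positivity) (by positivity)] at h1
      exact (pow_le_pow_iff_right₀ (by norm_num)).1 h1
    obtain ⟨e, rfl⟩ := Nat.exists_eq_add_of_le hle
    refine ⟨hle, ?_⟩
    rw [Nat.add_sub_cancel_left]
    exact (dyadicIcc_add_subset_iff _ _ _ _).1 h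
  · rintro ⟨hle, h⟩
    obtain ⟨e, rfl⟩ := Nat.exists_eq_add_of_le hle
    rw [Nat.add_sub_cancel_left] at h
    exact (dyadicIcc_add_subset_iff _ _ _ _).2 h

lemma dyadicIcc_inj {i i' a a' : ℕ} : dyadicIcc i a = dyadicIcc i' a' ↔ i = i' ∧ a = a' := by
  constructor
  · intro h
    obtain ⟨h1, h2⟩ := (dyadicIcc_subset_iff _ _ _ _).1 h.subset
    obtain ⟨h3, -⟩ := (dyadicIcc_subset_iff _ _ _ _).1 h.symm.subset
    obtain rfl := le_antisymm h1 h3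
    simpa using h2
  · rintro ⟨rfl, rfl⟩; rfl

lemma dyadicIcc_subset_of_common_subset {i i' r a a' c : ℕ} (hi : i ≤ i')
    (h : dyadicIcc r c ⊆ dyadicIcc i a) (h' : dyadicIcc r c ⊆ dyadicIcc i' a') :
    dyadicIcc i' a' ⊆ dyadicIcc i a := by
  rw [dyadicIcc_subset_iff] at *
  refine ⟨hi, ?_⟩
  rw [← h.2, ← h'.2, Nat.div_div_eq_div_mul, ← pow_add]
  congr 2
  omega

lemma dyadicIcc_inter_eq {i i' r a a' c : ℕ} (hi : i ≤ i')
    (h : dyadicIcc i a ∩ dyadicIcc i' a' = dyadicIcc r c) :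
    r = i' ∧ c = a' ∧ a' / 2 ^ (i' - i) = a := by
  have hs := dyadicIcc_subset_of_common_subset hi (h ▸ Set.inter_subset_left)
    (h ▸ Set.inter_subset_right)
  rw [Set.inter_eq_right.2 hs, dyadicIcc_inj] at h
  exact ⟨h.1.symm, h.2.symm, ((dyadicIcc_subset_iff _ _ _ _).1 hs).2⟩

lemma dyadicIcc_subset_of_interior {i i' a a' : ℕ} (hi : i ≤ i') {x : ℝ}
    (h : x ∈ interior (dyadicIcc i a)) (h' : x ∈ interior (dyadicIcc i' a')) :
    dyadicIcc i' a' ⊆ dyadicIcc i a := by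
  obtain ⟨e, rfl⟩ := Nat.exists_eq_add_of_le hi
  rw [dyadicIcc_add_subset_iff, nat_div_two_pow_eq_iff]
  rw [dyadicIcc, interior_Icc] at h h'
  have hp : (0 : ℝ) < 2 ^ i := by positivity
  have hq : (0 : ℝ) < 2 ^ e := by positivity
  obtain ⟨h1, h2⟩ := h
  obtain ⟨h3, h4⟩ := h'
  rw [pow_add] at h3 h4
  rw [div_lt_iff₀ (by positivity)] at h1 h3
  rw [lt_div_iff₀ (by positivity)] at h2 h4
  have h5 := mul_lt_mul_of_pos_right h1 hq
  have h6 := mul_lt_mul_of_pos_right h2 hq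
  have h7 : (a : ℝ) * 2 ^ e < a' + 1 := by nlinarith
  have h8 : (a' : ℝ) < (a + 1) * 2 ^ e := by nlinarith
  exact ⟨Nat.lt_succ_iff.1 (by exact_mod_cast h7), by exact_mod_cast h8⟩

lemma dyadicTile_subset_iff {i j a c i' j' a' c' : ℕ} :
    dyadicTile i j a c ⊆ dyadicTile i' j' a' c' ↔
      (i' ≤ i ∧ a / 2 ^ (i - i') = a') ∧ (j' ≤ j ∧ c / 2 ^ (j - j') = c') := by
  simp only [dyadicTile_eq_prod]
  rw [Set.prod_subset_prod_iff, ← dyadicIcc_subset_iff, ← dyadicIcc_subset_iff]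
  simp [(dyadicIcc_nonempty _ _).ne_empty]

lemma dyadicTile_inj {i j a c i' j' a' c' : ℕ} :
    dyadicTile i j a c = dyadicTile i' j' a' c' ↔ (i = i' ∧ a = a') ∧ (j = j' ∧ c = c') := by
  simp only [dyadicTile_eq_prod]
  rw [Set.prod_eq_prod_iff_of_nonempty ((dyadicIcc_nonempty _ _).prod (dyadicIcc_nonempty _ _)),
    dyadicIcc_inj, dyadicIcc_inj]

lemma levelTile_inj {n i a c i' a' c' : ℕ} :
    levelTile n i a c = levelTile n i' a' c' ↔ i = i' ∧ a = a' ∧ c = c' := by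
  rw [levelTile, levelTile, dyadicTile_inj]
  constructor
  · rintro ⟨⟨h1, h2⟩, h3, h4⟩; exact ⟨h1, h2, h4⟩
  · rintro ⟨rfl, rfl, rfl⟩; simp

lemma dyadicTile_inter {i j a c i' j' a' c' : ℕ} (hi : i ≤ i') (hj : j' ≤ j)
    (ha : a' / 2 ^ (i' - i) = a) (hc : c / 2 ^ (j - j') = c') :
    dyadicTile i j a c ∩ dyadicTile i' j' a' c' = dyadicTile i' j a' c := by
  simp only [dyadicTile_eq_prod]
  rw [Set.prod_inter_prod, Set.inter_eq_right.2 ((dyadicIcc_subset_iff _ _ _ _).2 ⟨hi, ha⟩),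
    Set.inter_eq_left.2 ((dyadicIcc_subset_iff _ _ _ _).2 ⟨hj, hc⟩)]

lemma isDyadicTile_iff {n : ℕ} {t : Set (ℝ × ℝ)} :
    IsDyadicTile n t ↔
      ∃ i a c, i ≤ n ∧ a < 2 ^ i ∧ c < 2 ^ (n - i) ∧ t = levelTile n i a c := by
  constructor
  · rintro ⟨i, j, a, c, rfl, ha, hc, rfl⟩
    exact ⟨i, a, c, by omega, ha, by simpa using hc, by simp [levelTile]⟩
  · rintro ⟨i, a, c, hi, ha, hc, rfl⟩
    exact ⟨i, n - i, a, c, by omega, ha, hc, rfl⟩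

lemma AdjacentTiles.symm {k : ℕ} {s t : Set (ℝ × ℝ)} (h : AdjacentTiles k s t) :
    AdjacentTiles k t s := by
  rwa [AdjacentTiles, Set.inter_comm]

lemma adjacentTiles_of_succ {n i a c a' c' : ℕ} (hi : i + 1 ≤ n) (ha : a' < 2 ^ (i + 1))
    (hc : c < 2 ^ (n - i)) (h : a' / 2 = a) (h' : c / 2 = c') :
    AdjacentTiles n (levelTile n i a c) (levelTile n (i + 1) a' c') := by
  rw [AdjacentTiles, levelTile, levelTile, dyadicTile_inter (Nat.le_succ i) (by omega) (by simpa)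
    (by rwa [show n - i - (n - (i + 1)) = 1 by omega, pow_one])]
  exact ⟨i + 1, n - i, a', c, by omega, ha, hc, rfl⟩

lemma adjacentTiles_of_le {n i a c i' a' c' : ℕ} (hi : i ≤ i') (hn : i' ≤ n)
    (h : AdjacentTiles n (levelTile n i a c) (levelTile n i' a' c')) :
    i' = i + 1 ∧ a' / 2 = a ∧ c / 2 = c' := by
  obtain ⟨r, s, x, y, hrs, -, -, h⟩ := h
  simp only [levelTile, dyadicTile_eq_prod] at h
  rw [Set.prod_inter_prod, eq_comm, Set.prod_eq_prod_iff_of_nonempty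
    ((dyadicIcc_nonempty _ _).prod (dyadicIcc_nonempty _ _))] at h
  obtain ⟨rfl, -, ha⟩ := dyadicIcc_inter_eq hi h.1.symm
  obtain ⟨rfl, -, hc⟩ := dyadicIcc_inter_eq (by omega) ((Set.inter_comm _ _).trans h.2.symm)
  obtain rfl : r = i + 1 := by omega
  rw [Nat.add_sub_cancel_left, pow_one] at ha
  rw [show n - i - (n - (i + 1)) = 1 by omega, pow_one] at hc
  exact ⟨rfl, ha, hc⟩

lemma adjacentTiles_levelTile {n i a c i' a' c' : ℕ} (hn : i ≤ n) (hn' : i' ≤ n)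
    (h : AdjacentTiles n (levelTile n i a c) (levelTile n i' a' c')) :
    (i' = i + 1 ∧ a' / 2 = a ∧ c / 2 = c') ∨ (i = i' + 1 ∧ a / 2 = a' ∧ c' / 2 = c) := by
  rcases le_total i i' with hi | hi
  · exact Or.inl (adjacentTiles_of_le hi hn' h)
  · exact Or.inr (adjacentTiles_of_le hi hn h.symm)

lemma isHorizChild_iff {k i a c : ℕ} {v : Set (ℝ × ℝ)} (hi : i ≤ k) (ha : a < 2 ^ i)
    (hc : c < 2 ^ (k - i)) :
    IsHorizChild v (levelTile k i a c) ↔ ∃ c', c' / 2 = c ∧ v = levelTile (k + 1) i a c' := by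
  simp only [levelTile, Nat.succ_sub hi]
  constructor
  · rintro ⟨i', j', a', c', -, -, h, hv⟩
    rw [dyadicTile_inj] at h
    obtain ⟨⟨rfl, rfl⟩, rfl, rfl⟩ := h
    rcases hv with rfl | rfl
    · exact ⟨2 * c, by omega, rfl⟩
    · exact ⟨2 * c + 1, by omega, rfl⟩
  · rintro ⟨c', h, rfl⟩
    refine ⟨i, k - i, a, c, ha, hc, rfl, ?_⟩
    rcases (by omega : c' = 2 * c ∨ c' = 2 * c + 1) with rfl | rfl <;> simp

lemma isVertChild_iff {k i a c : ℕ} {v : Set (ℝ × ℝ)} (ha : a < 2 ^ i)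
    (hc : c < 2 ^ (k - i)) :
    IsVertChild v (levelTile k i a c) ↔
      ∃ a', a' / 2 = a ∧ v = levelTile (k + 1) (i + 1) a' c := by
  simp only [levelTile, Nat.add_sub_add_right]
  constructor
  · rintro ⟨i', j', a', c', -, -, h, hv⟩
    rw [dyadicTile_inj] at h
    obtain ⟨⟨rfl, rfl⟩, rfl, rfl⟩ := h
    rcases hv with rfl | rfl
    · exact ⟨2 * a, by omega, rfl⟩
    · exact ⟨2 * a + 1, by omega, rfl⟩
  · rintro ⟨a', h, rfl⟩
    refine ⟨i, k - i, a, c, ha, hc, rfl, ?_⟩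
    rcases (by omega : a' = 2 * a ∨ a' = 2 * a + 1) with rfl | rfl <;> simp

/-- Coordinates of the tiles of a chain of order `k` with `b` bonds, starting at width `2⁻ᵐ`. -/
structure ChainCoords (k m b : ℕ) (P Q : ℕ → ℕ) : Prop where
  le : m + b ≤ k
  P_lt : ∀ d ≤ b, P d < 2 ^ (m + d)
  Q_lt : ∀ d ≤ b, Q d < 2 ^ (k - (m + d))
  P_half : ∀ d < b, P (d + 1) / 2 = P d
  Q_half : ∀ d < b, Q d / 2 = Q (d + 1)

/-- The set of tiles with the given chain coordinates. -/
def chainTiles (k m b : ℕ) (P Q : ℕ → ℕ) : Set (Set (ℝ × ℝ)) :=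
  {t | ∃ d ≤ b, t = levelTile k (m + d) (P d) (Q d)}

namespace ChainCoords

variable {k m b : ℕ} {P Q : ℕ → ℕ}

lemma P_add (h : ChainCoords k m b P Q) (d e : ℕ) (hd : d + e ≤ b) :
    P (d + e) / 2 ^ e = P d := by
  induction e with
  | zero => simp
  | succ e ih =>
    rw [pow_succ', ← Nat.div_div_eq_div_mul, ← add_assoc, h.P_half _ (by omega)]
    exact ih (by omega)

lemma Q_add (h : ChainCoords k m b P Q) (d e : ℕ) (hd : d + e ≤ b) :
    Q d / 2 ^ e = Q (d + e) := by
  induction e with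
  | zero => simp
  | succ e ih =>
    rw [pow_succ, ← Nat.div_div_eq_div_mul, ih (by omega), h.Q_half _ (by omega), add_assoc]

lemma setOf_subset_eq (h : ChainCoords k m b P Q) :
    {u | IsDyadicTile k u ∧ dyadicTile (m + b) (k - m) (P b) (Q 0) ⊆ u} =
      chainTiles k m b P Q := by
  have hle := h.le
  have hP : ∀ d ≤ b, P b / 2 ^ (b - d) = P d := fun d hd => by
    have := h.P_add d (b - d) (by omega)
    rwa [Nat.add_sub_cancel' hd] at this
  have hQ : ∀ d ≤ b, Q 0 / 2 ^ d = Q d := fun d hd => by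
    simpa using h.Q_add 0 d (by omega)
  ext u
  simp only [Set.mem_ofPred_eq, chainTiles]
  constructor
  · rintro ⟨hu, hsub⟩
    obtain ⟨i, a, c, hi, -, -, rfl⟩ := isDyadicTile_iff.1 hu
    rw [levelTile, dyadicTile_subset_iff] at hsub
    obtain ⟨⟨h1, h2⟩, h3, h4⟩ := hsub
    obtain ⟨d, rfl⟩ : ∃ d, i = m + d := ⟨i - m, by omega⟩
    have hd : d ≤ b := by omega
    refine ⟨d, hd, ?_⟩
    rw [show m + b - (m + d) = b - d by omega, hP d hd] at h2
    rw [show k - m - (k - (m + d)) = d by omega, hQ d hd] at h4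
    rw [h2, h4]
  · rintro ⟨d, hd, rfl⟩
    refine ⟨isDyadicTile_iff.2 ⟨_, _, _, by omega, h.P_lt d hd, h.Q_lt d hd, rfl⟩, ?_⟩
    rw [levelTile, dyadicTile_subset_iff, show m + b - (m + d) = b - d by omega, hP d hd,
      show k - m - (k - (m + d)) = d by omega, hQ d hd]
    omega

lemma adjacent (h : ChainCoords k m b P Q) {d : ℕ} (hd : d < b) :
    AdjacentTiles k (levelTile k (m + d) (P d) (Q d))
      (levelTile k (m + (d + 1)) (P (d + 1)) (Q (d + 1))) :=
  adjacentTiles_of_succ (by have := h.le; omega) (h.P_lt (d + 1) hd) (h.Q_lt d hd.le)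
    (h.P_half d hd) (h.Q_half d hd)

lemma isChainOf (h : ChainCoords k m b P Q) : IsChainOf k (chainTiles k m b P Q) := by
  have hle := h.le
  have hinter : levelTile k (m + 0) (P 0) (Q 0) ∩ levelTile k (m + b) (P b) (Q b) =
      dyadicTile (m + b) (k - m) (P b) (Q 0) := by
    refine dyadicTile_inter (by omega) (by omega) ?_ ?_
    · simpa using h.P_add 0 b (by omega)
    · rw [show k - (m + 0) - (k - (m + b)) = b by omega]
      simpa using h.Q_add 0 b (by omega)
  refine ⟨_, _, isDyadicTile_iff.2 ⟨_, _, _, by omega, h.P_lt 0 (by omega), h.Q_lt 0 (by omega),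
    rfl⟩, isDyadicTile_iff.2 ⟨_, _, _, by omega, h.P_lt b le_rfl, h.Q_lt b le_rfl, rfl⟩, ?_, ?_⟩
  · rw [← interior_inter, hinter, dyadicTile_eq_prod, interior_prod_eq]
    simp only [dyadicIcc, interior_Icc]
    exact (Set.nonempty_Ioo.2 (dyadicIcc_endpoints_lt _ _)).prod
      (Set.nonempty_Ioo.2 (dyadicIcc_endpoints_lt _ _))
  · rw [hinter, h.setOf_subset_eq]

end ChainCoords

lemma exists_chainCoords_of_le {k i a c i' a' c' : ℕ} (hi : i ≤ i') (hk : i' ≤ k)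
    (ha : a' < 2 ^ i') (hc : c < 2 ^ (k - i))
    (hne : (interior (levelTile k i a c) ∩ interior (levelTile k i' a' c')).Nonempty) :
    ∃ m b P Q, ChainCoords k m b P Q ∧
      {u | IsDyadicTile k u ∧ levelTile k i a c ∩ levelTile k i' a' c' ⊆ u} =
        chainTiles k m b P Q := by
  obtain ⟨b, rfl⟩ := Nat.exists_eq_add_of_le hi
  obtain ⟨⟨x, y⟩, hx, hy⟩ := hne
  simp only [levelTile, dyadicTile_eq_prod, interior_prod_eq] at hx hy
  have h1 := dyadicIcc_subset_of_interior hi hx.1 hy.1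
  have h2 := dyadicIcc_subset_of_interior (by omega) hy.2 hx.2
  rw [dyadicIcc_subset_iff] at h1 h2
  have hco : ChainCoords k i b (fun d => a' / 2 ^ (b - d)) (fun d => c / 2 ^ d) := by
    refine ⟨hk, fun d hd => ?_, fun d hd => ?_, fun d hd => ?_, fun d hd => ?_⟩
    · rw [Nat.div_lt_iff_lt_mul (by positivity), ← pow_add]
      rwa [show i + d + (b - d) = i + b by omega]
    · rw [Nat.div_lt_iff_lt_mul (by positivity), ← pow_add]
      rwa [show k - (i + d) + d = k - i by omega]
    · rw [Nat.div_div_eq_div_mul, ← pow_succ, show b - (d + 1) + 1 = b - d by omega]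
    · rw [Nat.div_div_eq_div_mul, ← pow_succ]
  refine ⟨_, _, _, _, hco, ?_⟩
  rw [← hco.setOf_subset_eq, levelTile, levelTile, dyadicTile_inter hi (by omega) h1.2 h2.2]
  simp

lemma isChainOf_iff {k : ℕ} {C : Set (Set (ℝ × ℝ))} :
    IsChainOf k C ↔ ∃ m b P Q, ChainCoords k m b P Q ∧ C = chainTiles k m b P Q := by
  constructor
  · rintro ⟨s, t, hs, ht, hne, rfl⟩
    obtain ⟨i, a, c, hi, ha, hc, rfl⟩ := isDyadicTile_iff.1 hs
    obtain ⟨i', a', c', hi', ha', hc', rfl⟩ := isDyadicTile_iff.1 ht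
    rcases le_total i i' with h | h
    · exact exists_chainCoords_of_le h hi' ha' hc hne
    · rw [Set.inter_comm (levelTile k i a c)]
      exact exists_chainCoords_of_le h hi ha hc' (by rwa [Set.inter_comm])
  · rintro ⟨m, b, P, Q, h, rfl⟩
    exact h.isChainOf

lemma bondCount_eq_of_forall {k n : ℕ} {S : Set (Set (ℝ × ℝ))} (f g : ℕ → Set (ℝ × ℝ))
    (hadj : ∀ d < n, f d ∈ S ∧ g d ∈ S ∧ AdjacentTiles k (f d) (g d))
    (hinj : Function.Injective f) (hne : ∀ d e, f d = g e → g d ≠ f e)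
    (hall : ∀ s ∈ S, ∀ t ∈ S, AdjacentTiles k s t →
      ∃ d < n, (s = f d ∧ t = g d) ∨ (s = g d ∧ t = f d)) :
    bondCount k S = n := by
  have hset : {P : Set (ℝ × ℝ) × Set (ℝ × ℝ) | P.1 ∈ S ∧ P.2 ∈ S ∧ AdjacentTiles k P.1 P.2} =
      (fun d => (f d, g d)) '' Set.Iio n ∪ (fun d => (g d, f d)) '' Set.Iio n := by
    ext ⟨s, t⟩
    simp only [Set.mem_ofPred_eq, Set.mem_union, Set.mem_image, Set.mem_Iio, Prod.mk.injEq]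
    constructor
    · rintro ⟨hs, ht, h⟩
      obtain ⟨d, hd, ⟨rfl, rfl⟩ | ⟨rfl, rfl⟩⟩ := hall s hs t ht h
      · exact Or.inl ⟨d, hd, rfl, rfl⟩
      · exact Or.inr ⟨d, hd, rfl, rfl⟩
    · rintro (⟨d, hd, rfl, rfl⟩ | ⟨d, hd, rfl, rfl⟩)
      · exact hadj d hd
      · exact ⟨(hadj d hd).2.1, (hadj d hd).1, (hadj d hd).2.2.symm⟩
  rw [bondCount, hset, Set.ncard_union_eq, Set.ncard_image_of_injective,
    Set.ncard_image_of_injective, Set.ncard_Iio_nat]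
  · omega
  · exact fun d e h => hinj (congrArg Prod.snd h)
  · exact fun d e h => hinj (congrArg Prod.fst h)
  · rw [Set.disjoint_left]
    rintro _ ⟨d, -, rfl⟩ ⟨e, -, h⟩
    rw [Prod.mk.injEq] at h
    exact hne d e h.1.symm h.2.symm

lemma ChainCoords.bondCount {k m b : ℕ} {P Q : ℕ → ℕ} (h : ChainCoords k m b P Q) :
    bondCount k (chainTiles k m b P Q) = b := by
  have hle := h.le
  refine bondCount_eq_of_forall (fun d => levelTile k (m + d) (P d) (Q d))
    (fun d => levelTile k (m + (d + 1)) (P (d + 1)) (Q (d + 1)))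
    (fun d hd => ⟨⟨d, hd.le, rfl⟩, ⟨d + 1, hd, rfl⟩, h.adjacent hd⟩) ?_ ?_ ?_
  · intro d e hde
    have := (levelTile_inj.1 hde).1
    omega
  · intro d e h1 h2
    have := (levelTile_inj.1 h1).1
    have := (levelTile_inj.1 h2).1
    omega
  · rintro _ ⟨d, hd, rfl⟩ _ ⟨e, he, rfl⟩ hadj
    rcases adjacentTiles_levelTile (by omega) (by omega) hadj with ⟨h1, -⟩ | ⟨h1, -⟩
    · obtain rfl : e = d + 1 := by omega
      exact ⟨d, by omega, Or.inl ⟨rfl, rfl⟩⟩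
    · obtain rfl : d = e + 1 := by omega
      exact ⟨e, by omega, Or.inr ⟨rfl, rfl⟩⟩

lemma IsChainOf.nonempty {k : ℕ} {C : Set (Set (ℝ × ℝ))} (hC : IsChainOf k C) : C.Nonempty := by
  obtain ⟨m, b, P, Q, -, rfl⟩ := isChainOf_iff.1 hC
  exact ⟨_, 0, Nat.zero_le b, rfl⟩

/-- Chains are connected under adjacency. -/
lemma IsChainOf.subset_of_adjacent_closed {k : ℕ} {C E : Set (Set (ℝ × ℝ))} (hC : IsChainOf k C)
    (hne : (C ∩ E).Nonempty)
    (hcl : ∀ x ∈ C, x ∈ E → ∀ y ∈ C, AdjacentTiles k x y → y ∈ E) : C ⊆ E := by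
  obtain ⟨m, b, P, Q, h, rfl⟩ := isChainOf_iff.1 hC
  obtain ⟨_, ⟨d, hd, rfl⟩, hdE⟩ := hne
  have step : ∀ e < b, (levelTile k (m + e) (P e) (Q e) ∈ E ↔
      levelTile k (m + (e + 1)) (P (e + 1)) (Q (e + 1)) ∈ E) := fun e he =>
    ⟨fun hE => hcl _ ⟨e, he.le, rfl⟩ hE _ ⟨e + 1, he, rfl⟩ (h.adjacent he),
      fun hE => hcl _ ⟨e + 1, he, rfl⟩ hE _ ⟨e, he.le, rfl⟩ (h.adjacent he).symm⟩
  have base : ∀ e ≤ b, (levelTile k (m + e) (P e) (Q e) ∈ E ↔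
      levelTile k (m + 0) (P 0) (Q 0) ∈ E) := by
    intro e he
    induction e with
    | zero => rfl
    | succ e ih => rw [← step e he, ih (by omega)]
  rintro _ ⟨e, he, rfl⟩
  exact (base e he).2 ((base d hd).1 hdE)

lemma SeparateChains.symm {k : ℕ} {C D : Set (Set (ℝ × ℝ))} (h : SeparateChains k C D) :
    SeparateChains k D C :=
  ⟨h.1.symm, fun u hu v hv huv => h.2 v hv u hu huv.symm⟩

/-- `𝒞` is a family of pairwise separate chains of order `k` with union `S`. -/
def IsSeparateDecomposition (k : ℕ) (𝒞 : Set (Set (Set (ℝ × ℝ)))) (S : Set (Set (ℝ × ℝ))) :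
    Prop :=
  (∀ D ∈ 𝒞, IsChainOf k D) ∧ 𝒞.Pairwise (SeparateChains k) ∧ ⋃₀ 𝒞 = S

namespace IsSeparateDecomposition

variable {k : ℕ} {𝒞 𝒟 : Set (Set (Set (ℝ × ℝ)))} {S : Set (Set (ℝ × ℝ))}

lemma chain_subset (h : IsSeparateDecomposition k 𝒞 S) {D E : Set (Set (ℝ × ℝ))}
    (hD : IsChainOf k D) (hDS : D ⊆ S) (hE : E ∈ 𝒞) (hne : (D ∩ E).Nonempty) : D ⊆ E := by
  refine hD.subset_of_adjacent_closed hne fun x _ hxE y hy hxy => ?_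
  obtain ⟨E', hE', hyE'⟩ := Set.mem_sUnion.1 (h.2.2 ▸ hDS hy)
  by_cases hEE : E = E'
  · rwa [hEE]
  · exact absurd hxy ((h.2.1 hE hE' hEE).2 x hxE y hyE')

lemma subset (h : IsSeparateDecomposition k 𝒞 S) (h' : IsSeparateDecomposition k 𝒟 S) :
    𝒞 ⊆ 𝒟 := by
  intro D hD
  have hsub : ∀ {𝒟 : Set (Set (Set (ℝ × ℝ)))}, IsSeparateDecomposition k 𝒟 S →
      ∀ E ∈ 𝒟, E ⊆ S := fun h E hE => h.2.2 ▸ Set.subset_sUnion_of_mem hE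
  obtain ⟨t, ht⟩ := (h.1 D hD).nonempty
  obtain ⟨E, hE, htE⟩ := Set.mem_sUnion.1 (h'.2.2 ▸ hsub h D hD ht)
  have h1 := h'.chain_subset (h.1 D hD) (hsub h D hD) hE ⟨t, ht, htE⟩
  have h2 := h.chain_subset (h'.1 E hE) (hsub h' E hE) hD ⟨t, htE, ht⟩
  rwa [h1.antisymm h2]

lemma unique (h : IsSeparateDecomposition k 𝒞 S) (h' : IsSeparateDecomposition k 𝒟 S) :
    𝒞 = 𝒟 :=
  (h.subset h').antisymm (h'.subset h)

end IsSeparateDecomposition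

/-- Coordinates of a successor of a chain: `pv d` is the horizontal index of the vertical child
and `qh d` the vertical index of the horizontal child of the `d`-th tile of the chain. -/
structure SuccCoords (k m b : ℕ) (P Q pv qh : ℕ → ℕ) : Prop extends ChainCoords k m b P Q where
  pv_half : ∀ d ≤ b, pv d / 2 = P d
  qh_half : ∀ d ≤ b, qh d / 2 = Q d
  link : ∀ d < b, (pv d = P (d + 1) ↔ qh (d + 1) = Q d)

/-- The set of tiles with the given successor coordinates, restricted to the children of the
tiles of the chain with index in `[u, v]`. -/
def succTiles (k m : ℕ) (P Q pv qh : ℕ → ℕ) (u v : ℕ) : Set (Set (ℝ × ℝ)) :=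
  {t | ∃ d, u ≤ d ∧ d ≤ v ∧ (t = levelTile (k + 1) (m + d) (P d) (qh d) ∨
    t = levelTile (k + 1) (m + (d + 1)) (pv d) (Q d))}

/-- The indices at which a successor breaks into separate chains. -/
def succBreaks (b : ℕ) (P pv : ℕ → ℕ) : Finset ℕ :=
  (Finset.range b).filter fun d => pv d ≠ P (d + 1)

lemma mem_succBreaks {b d : ℕ} {P pv : ℕ → ℕ} :
    d ∈ succBreaks b P pv ↔ d < b ∧ pv d ≠ P (d + 1) := by
  simp [succBreaks]

namespace SuccCoords

variable {k m b : ℕ} {P Q pv qh : ℕ → ℕ}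

lemma eq_qh_of_mem (h : SuccCoords k m b P Q pv qh) {d c : ℕ} (hd : d ≤ b)
    (hmem : levelTile (k + 1) (m + d) (P d) c ∈ succTiles k m P Q pv qh 0 b) : c = qh d := by
  obtain ⟨e, -, he, heq | heq⟩ := hmem <;> rw [levelTile_inj] at heq
  · obtain rfl : d = e := by omega
    exact heq.2.2
  · obtain rfl : d = e + 1 := by omega
    rw [heq.2.2]
    exact ((h.link e hd).1 heq.2.1.symm).symm

lemma eq_pv_of_mem (h : SuccCoords k m b P Q pv qh) {d a : ℕ}
    (hmem : levelTile (k + 1) (m + (d + 1)) a (Q d) ∈ succTiles k m P Q pv qh 0 b) :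
    a = pv d := by
  obtain ⟨e, -, he, heq | heq⟩ := hmem <;> rw [levelTile_inj] at heq
  · obtain rfl : e = d + 1 := by omega
    rw [heq.2.1]
    exact ((h.link d he).2 heq.2.2.symm).symm
  · obtain rfl : d = e := by omega
    exact heq.2.1

lemma adjacent (h : SuccCoords k m b P Q pv qh) {d : ℕ} (hd : d ≤ b) :
    AdjacentTiles (k + 1) (levelTile (k + 1) (m + d) (P d) (qh d))
      (levelTile (k + 1) (m + (d + 1)) (pv d) (Q d)) := by
  have h1 := h.pv_half d hd
  have h2 := h.qh_half d hd
  have h3 := h.P_lt d hd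
  have h4 := h.Q_lt d hd
  have hle := h.le
  refine adjacentTiles_of_succ (by omega) ?_ ?_ h1 h2
  · rw [pow_succ]; omega
  · rw [show k + 1 - (m + d) = k - (m + d) + 1 by omega, pow_succ]; omega

lemma exists_bond_of_le (h : SuccCoords k m b P Q pv qh) {i a c a' c' : ℕ}
    (hs : levelTile (k + 1) i a c ∈ succTiles k m P Q pv qh 0 b)
    (ht : levelTile (k + 1) (i + 1) a' c' ∈ succTiles k m P Q pv qh 0 b)
    (ha : a' / 2 = a) (hc : c / 2 = c') :
    ∃ f ≤ b, levelTile (k + 1) i a c = levelTile (k + 1) (m + f) (P f) (qh f) ∧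
      levelTile (k + 1) (i + 1) a' c' = levelTile (k + 1) (m + (f + 1)) (pv f) (Q f) := by
  obtain ⟨d, -, hd, hs⟩ := hs
  obtain ⟨e, -, he, ht⟩ := ht
  simp only [levelTile_inj] at *
  rcases hs with ⟨rfl, rfl, rfl⟩ | ⟨rfl, rfl, rfl⟩ <;> obtain ⟨h1, rfl, h2⟩ | ⟨h1, rfl, h2⟩ := ht
  · obtain rfl : e = d + 1 := by omega
    rw [h.qh_half d hd] at hc
    exact ⟨d, hd, ⟨rfl, rfl, rfl⟩, h1, ((h.link d he).2 (by omega)).symm, hc.symm⟩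
  · obtain rfl : e = d := by omega
    exact ⟨e, he, ⟨rfl, rfl, rfl⟩, rfl, rfl, h2⟩
  · obtain rfl : e = d + 2 := by omega
    rw [h.P_half (d + 1) he] at ha
    rw [h.Q_half d (by omega)] at hc
    exact ⟨d + 1, by omega, ⟨rfl, ha.symm, ((h.link d (by omega)).1 ha.symm).symm⟩, rfl,
      ((h.link (d + 1) he).2 (h2.symm.trans hc.symm)).symm, hc.symm⟩
  · obtain rfl : e = d + 1 := by omega
    rw [h.pv_half (d + 1) he] at ha
    exact ⟨d + 1, he, ⟨rfl, ha.symm, ((h.link d he).1 ha.symm).symm⟩, rfl, rfl, h2⟩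

lemma exists_levelTile (h : SuccCoords k m b P Q pv qh) {s : Set (ℝ × ℝ)}
    (hs : s ∈ succTiles k m P Q pv qh 0 b) :
    ∃ i a c, i ≤ k + 1 ∧ s = levelTile (k + 1) i a c := by
  have := h.le
  obtain ⟨d, -, hd, rfl | rfl⟩ := hs
  · exact ⟨_, _, _, by omega, rfl⟩
  · exact ⟨_, _, _, by omega, rfl⟩

lemma exists_bond (h : SuccCoords k m b P Q pv qh) {s t : Set (ℝ × ℝ)}
    (hs : s ∈ succTiles k m P Q pv qh 0 b) (ht : t ∈ succTiles k m P Q pv qh 0 b)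
    (hadj : AdjacentTiles (k + 1) s t) :
    ∃ f ≤ b, (s = levelTile (k + 1) (m + f) (P f) (qh f) ∧
        t = levelTile (k + 1) (m + (f + 1)) (pv f) (Q f)) ∨
      (s = levelTile (k + 1) (m + (f + 1)) (pv f) (Q f) ∧
        t = levelTile (k + 1) (m + f) (P f) (qh f)) := by
  obtain ⟨i, a, c, hi, rfl⟩ := h.exists_levelTile hs
  obtain ⟨i', a', c', hi', rfl⟩ := h.exists_levelTile ht
  rcases adjacentTiles_levelTile hi hi' hadj with ⟨rfl, ha, hc⟩ | ⟨rfl, ha, hc⟩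
  · obtain ⟨f, hf, h1, h2⟩ := h.exists_bond_of_le hs ht ha hc
    exact ⟨f, hf, Or.inl ⟨h1, h2⟩⟩
  · obtain ⟨f, hf, h1, h2⟩ := h.exists_bond_of_le ht hs ha hc
    exact ⟨f, hf, Or.inr ⟨h2, h1⟩⟩

lemma bondCount (h : SuccCoords k m b P Q pv qh) :
    bondCount (k + 1) (succTiles k m P Q pv qh 0 b) = b + 1 := by
  refine bondCount_eq_of_forall (fun d => levelTile (k + 1) (m + d) (P d) (qh d))
    (fun d => levelTile (k + 1) (m + (d + 1)) (pv d) (Q d))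
    (fun d hd => ⟨⟨d, Nat.zero_le d, by omega, Or.inl rfl⟩, ⟨d, Nat.zero_le d, by omega,
      Or.inr rfl⟩, h.adjacent (by omega)⟩) ?_ ?_ ?_
  · intro d e hde
    have := (levelTile_inj.1 hde).1
    omega
  · intro d e h1 h2
    have := (levelTile_inj.1 h1).1
    have := (levelTile_inj.1 h2).1
    omega
  · intro s hs t ht hadj
    obtain ⟨f, hf, hst⟩ := h.exists_bond hs ht hadj
    exact ⟨f, by omega, hst⟩

end SuccCoords

/-- `[u, v]` is a maximal interval in `[0, b]` with no element of `B` in `[u, v)`. -/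
structure IsSegment (b : ℕ) (B : Finset ℕ) (u v : ℕ) : Prop where
  le : u ≤ v
  le_last : v ≤ b
  left : u = 0 ∨ u - 1 ∈ B
  right : v = b ∨ v ∈ B
  notMem : ∀ d, u ≤ d → d < v → d ∉ B

namespace IsSegment

variable {b u v u' v' d : ℕ} {B : Finset ℕ}

lemma not_lt (h : IsSegment b B u v) (h' : IsSegment b B u' v') (hv : d ≤ v) (hu' : u' ≤ d) :
    ¬ v < v' := by
  intro hlt
  have h1 := h'.le_last
  rcases h.right with h2 | h2
  · omega
  · exact h'.notMem v (by omega) hlt h2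

lemma right_unique (h : IsSegment b B u v) (h' : IsSegment b B u' v') (hu : u ≤ d) (hv : d ≤ v)
    (hu' : u' ≤ d) (hv' : d ≤ v') : v = v' :=
  le_antisymm (_root_.not_lt.1 (h'.not_lt h hv' hu)) (_root_.not_lt.1 (h.not_lt h' hv hu'))

lemma exists_left (v : ℕ) (hv : v ≤ b) (hB : v = b ∨ v ∈ B) : ∃ u, IsSegment b B u v := by
  have key : ∀ v, ∃ u ≤ v, (u = 0 ∨ u - 1 ∈ B) ∧ ∀ d, u ≤ d → d < v → d ∉ B := by
    intro v
    induction v with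
    | zero => exact ⟨0, le_rfl, Or.inl rfl, by simp⟩
    | succ v ih =>
      by_cases hvB : v ∈ B
      · exact ⟨v + 1, le_rfl, Or.inr hvB, by omega⟩
      · obtain ⟨u, hu, h1, h2⟩ := ih
        refine ⟨u, by omega, h1, fun d hd hdv => ?_⟩
        rcases Nat.lt_succ_iff_lt_or_eq.1 hdv with h | rfl
        · exact h2 d hd h
        · exact hvB
  obtain ⟨u, hu, h1, h2⟩ := key v
  exact ⟨u, hu, hv, h1, hB, h2⟩

lemma exists_right (d : ℕ) (hd : d ≤ b) :
    ∃ v, d ≤ v ∧ v ≤ b ∧ (v = b ∨ v ∈ B) ∧ ∀ e, d ≤ e → e < v → e ∉ B := by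
  induction hd using Nat.decreasingInduction with
  | self => exact ⟨b, le_rfl, le_rfl, Or.inl rfl, by omega⟩
  | of_succ d hd ih =>
    by_cases hdB : d ∈ B
    · exact ⟨d, le_rfl, hd.le, Or.inr hdB, by omega⟩
    · obtain ⟨v, h1, h2, h3, h4⟩ := ih
      refine ⟨v, by omega, h2, h3, fun e he hev => ?_⟩
      rcases he.eq_or_lt with rfl | h
      · exact hdB
      · exact h4 e h hev

lemma exists_mem (d : ℕ) (hd : d ≤ b) : ∃ u v, IsSegment b B u v ∧ u ≤ d ∧ d ≤ v := by
  obtain ⟨v, h1, h2, h3, h4⟩ := exists_right (B := B) d hd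
  obtain ⟨u, hu⟩ := exists_left v h2 h3
  refine ⟨u, v, hu, ?_, h1⟩
  by_contra! hlt
  have h5 := hu.le
  rcases hu.left with h | h
  · omega
  · exact h4 (u - 1) (by omega) (by omega) h

end IsSegment

namespace SuccCoords

variable {k m b u v : ℕ} {P Q pv qh : ℕ → ℕ}

lemma isChainOf_succTiles (h : SuccCoords k m b P Q pv qh)
    (hs : IsSegment b (succBreaks b P pv) u v) :
    IsChainOf (k + 1) (succTiles k m P Q pv qh u v) := by
  have hle := h.le
  have huv := hs.le
  have hvb := hs.le_last
  have hP : ∀ d, u ≤ d → d < v → pv d = P (d + 1) := fun d h1 h2 => by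
    have := hs.notMem d h1 h2
    rw [mem_succBreaks] at this
    by_contra hne
    exact this ⟨by omega, hne⟩
  have hQ : ∀ d, u ≤ d → d < v → qh (d + 1) = Q d := fun d h1 h2 =>
    (h.link d (by omega)).1 (hP d h1 h2)
  refine isChainOf_iff.2 ⟨m + u, v - u + 1, fun | 0 => P u | e + 1 => pv (u + e),
    fun | 0 => qh u | e + 1 => Q (u + e), ⟨by omega, ?_, ?_, ?_, ?_⟩, ?_⟩
  · rintro (_ | e) he
    · exact h.P_lt u (by omega)
    · have h1 := h.P_lt (u + e) (by omega)
      have h2 := h.pv_half (u + e) (by omega)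
      change pv (u + e) < _
      rw [show m + u + (e + 1) = m + (u + e) + 1 by omega, pow_succ]
      omega
  · rintro (_ | e) he
    · have h1 := h.Q_lt u (by omega)
      have h2 := h.qh_half u (by omega)
      change qh u < _
      rw [show k + 1 - (m + u + 0) = k - (m + u) + 1 by omega, pow_succ]
      omega
    · have h1 := h.Q_lt (u + e) (by omega)
      rw [show k + 1 - (m + u + (e + 1)) = k - (m + (u + e)) by omega]
      exact h1
  · rintro (_ | e) he
    · exact h.pv_half u (by omega)
    · exact (h.pv_half (u + (e + 1)) (by omega)).trans (hP (u + e) (by omega) (by omega)).symm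
  · rintro (_ | e) he
    · exact h.qh_half u (by omega)
    · exact h.Q_half (u + e) (by omega)
  · ext t
    constructor
    · rintro ⟨d, hud, hdv, rfl | rfl⟩
      · rcases hud.eq_or_lt with rfl | hlt
        · exact ⟨0, by omega, by simp⟩
        · obtain ⟨e, rfl⟩ := Nat.exists_eq_add_of_lt hlt
          refine ⟨e + 1, by omega, ?_⟩
          rw [hQ _ (by omega) (by omega), ← hP _ (by omega) (by omega)]
          simp only [add_assoc]
      · obtain ⟨e, rfl⟩ := Nat.exists_eq_add_of_le hud
        refine ⟨e + 1, by omega, ?_⟩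
        simp only [add_assoc]
    · rintro ⟨_ | e, he, rfl⟩
      · exact ⟨u, le_rfl, huv, Or.inl (by simp)⟩
      · refine ⟨u + e, by omega, by omega, Or.inr ?_⟩
        simp only [add_assoc]

lemma horiz_mem_segment (hs : IsSegment b (succBreaks b P pv) u v) {d : ℕ} (hd : d ≤ b)
    (hmem : levelTile (k + 1) (m + d) (P d) (qh d) ∈ succTiles k m P Q pv qh u v) :
    u ≤ d ∧ d ≤ v := by
  obtain ⟨e, h1, h2, heq | heq⟩ := hmem <;> rw [levelTile_inj] at heq
  · omega
  · obtain rfl : d = e + 1 := by omega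
    refine ⟨by omega, ?_⟩
    by_contra hlt
    obtain rfl : e = v := by omega
    rcases hs.right with hr | hr
    · omega
    · exact (mem_succBreaks.1 hr).2 heq.2.1.symm

lemma vert_mem_segment (hs : IsSegment b (succBreaks b P pv) u v) {d : ℕ}
    (hmem : levelTile (k + 1) (m + (d + 1)) (pv d) (Q d) ∈ succTiles k m P Q pv qh u v) :
    u ≤ d ∧ d ≤ v := by
  obtain ⟨e, h1, h2, heq | heq⟩ := hmem <;> rw [levelTile_inj] at heq
  · obtain rfl : e = d + 1 := by omega
    refine ⟨?_, by omega⟩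
    by_contra hlt
    obtain rfl : u = d + 1 := by omega
    rcases hs.left with hr | hr
    · omega
    · exact (mem_succBreaks.1 hr).2 heq.2.1
  · omega

lemma succTiles_mono {u' v' : ℕ} (hu : u' ≤ u) (hv : v ≤ v') :
    succTiles k m P Q pv qh u v ⊆ succTiles k m P Q pv qh u' v' :=
  fun _ ⟨d, h1, h2, h3⟩ => ⟨d, by omega, by omega, h3⟩

lemma right_eq_of_mem {u' v' : ℕ} (hs : IsSegment b (succBreaks b P pv) u v) (hs' : IsSegment b (succBreaks b P pv) u' v')
    {t : Set (ℝ × ℝ)} (ht : t ∈ succTiles k m P Q pv qh u v)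
    (ht' : t ∈ succTiles k m P Q pv qh u' v') : v = v' := by
  have hvb := hs.le_last
  obtain ⟨d, h1, h2, rfl | rfl⟩ := ht
  · obtain ⟨h3, h4⟩ := horiz_mem_segment hs' (by omega) ht'
    exact hs.right_unique hs' h1 h2 h3 h4
  · obtain ⟨h3, h4⟩ := vert_mem_segment hs' ht'
    exact hs.right_unique hs' h1 h2 h3 h4

lemma right_eq_of_adjacent {u' v' : ℕ} (h : SuccCoords k m b P Q pv qh)
    (hs : IsSegment b (succBreaks b P pv) u v) (hs' : IsSegment b (succBreaks b P pv) u' v')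
    {s t : Set (ℝ × ℝ)} (hsm : s ∈ succTiles k m P Q pv qh u v)
    (ht : t ∈ succTiles k m P Q pv qh u' v') (hst : AdjacentTiles (k + 1) s t) : v = v' := by
  obtain ⟨f, hf, ⟨rfl, rfl⟩ | ⟨rfl, rfl⟩⟩ := h.exists_bond
    (succTiles_mono (Nat.zero_le _) hs.le_last hsm)
    (succTiles_mono (Nat.zero_le _) hs'.le_last ht) hst
  · obtain ⟨h1, h2⟩ := horiz_mem_segment hs hf hsm
    obtain ⟨h3, h4⟩ := vert_mem_segment hs' ht
    exact hs.right_unique hs' h1 h2 h3 h4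
  · obtain ⟨h1, h2⟩ := vert_mem_segment hs hsm
    obtain ⟨h3, h4⟩ := horiz_mem_segment hs' hf ht
    exact hs.right_unique hs' h1 h2 h3 h4

lemma exists_decomposition (h : SuccCoords k m b P Q pv qh) :
    ∃ 𝒞, IsSeparateDecomposition (k + 1) 𝒞 (succTiles k m P Q pv qh 0 b) ∧
      𝒞.ncard = (succBreaks b P pv).card + 1 := by
  classical
  set B := succBreaks b P pv with hB
  have hbB : b ∉ B := fun hb => (mem_succBreaks.1 hb).1.false
  have hex : ∀ v : ℕ, ∃ u, v ∈ insert b B → IsSegment b B u v := by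
    intro v
    by_cases hv : v ∈ insert b B
    · obtain ⟨u, hu⟩ := IsSegment.exists_left (b := b) (B := B) v (by
        rcases Finset.mem_insert.1 hv with rfl | hv
        · exact le_rfl
        · exact (mem_succBreaks.1 hv).1.le) (Finset.mem_insert.1 hv)
      exact ⟨u, fun _ => hu⟩
    · exact ⟨0, fun hv' => absurd hv' hv⟩
  choose st hst using hex
  have hinj : Set.InjOn (fun v => succTiles k m P Q pv qh (st v) v) (insert b B : Finset ℕ) := by
    intro v hv v' hv' heq
    have hmem : levelTile (k + 1) (m + v) (P v) (qh v) ∈ succTiles k m P Q pv qh (st v) v :=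
      ⟨v, (hst v hv).le, le_rfl, Or.inl rfl⟩
    exact right_eq_of_mem (hst v hv) (hst v' hv') hmem ((Set.ext_iff.1 heq _).1 hmem)
  refine ⟨(fun v => succTiles k m P Q pv qh (st v) v) '' (insert b B : Finset ℕ),
    ⟨?_, ?_, ?_⟩, ?_⟩
  · rintro _ ⟨v, hv, rfl⟩
    exact h.isChainOf_succTiles (hst v hv)
  · rintro _ ⟨v, hv, rfl⟩ _ ⟨v', hv', rfl⟩ hne
    refine ⟨Set.disjoint_left.2 fun t ht ht' => hne ?_, fun s hs t ht hadj => hne ?_⟩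
    · rw [right_eq_of_mem (hst v hv) (hst v' hv') ht ht']
    · rw [h.right_eq_of_adjacent (hst v hv) (hst v' hv') hs ht hadj]
  · ext t
    constructor
    · rintro ⟨_, ⟨v, hv, rfl⟩, ht⟩
      exact succTiles_mono (Nat.zero_le _) (hst v hv).le_last ht
    · rintro ⟨d, -, hd, ht⟩
      obtain ⟨u, v, hs, h1, h2⟩ := IsSegment.exists_mem (B := B) d hd
      have hv : v ∈ insert b B := Finset.mem_insert.2 hs.right
      refine ⟨_, ⟨v, hv, rfl⟩, d, ?_, h2, ht⟩
      by_contra! hlt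
      have h3 := (hst v hv).le
      rcases (hst v hv).left with h4 | h4
      · omega
      · exact hs.notMem _ (by omega) (by omega) h4
  · rw [hinj.ncard_image, Set.ncard_coe_finset, Finset.card_insert_of_notMem hbB]

end SuccCoords

/-- The other natural number with the same half as `n`. -/
def halfSibling (n : ℕ) : ℕ := 2 * (n / 2) + (1 - n % 2)

lemma halfSibling_half (n : ℕ) : halfSibling n / 2 = n / 2 := by
  unfold halfSibling; omega

lemma halfSibling_ne (n : ℕ) : halfSibling n ≠ n := by
  unfold halfSibling; omega

lemma eq_halfSibling {n r : ℕ} (h : r / 2 = n / 2) (hne : r ≠ n) : r = halfSibling n := by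
  unfold halfSibling; omega

/-- Horizontal indices of the vertical children in the successor with last choice `y` and
breaks `B`. -/
def codeVert (b : ℕ) (P : ℕ → ℕ) (y : ℕ) (B : Finset ℕ) (d : ℕ) : ℕ :=
  if d = b then 2 * P b + y else if d ∈ B then halfSibling (P (d + 1)) else P (d + 1)

/-- Vertical indices of the horizontal children in the successor with first choice `x` and
breaks `B`. -/
def codeHoriz (Q : ℕ → ℕ) (x : ℕ) (B : Finset ℕ) : ℕ → ℕ
  | 0 => 2 * Q 0 + x
  | d + 1 => if d ∈ B then halfSibling (Q d) else Q d

namespace ChainCoords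

variable {k m b : ℕ} {P Q : ℕ → ℕ}

lemma succCoords_code (h : ChainCoords k m b P Q) {x y : ℕ} (hx : x < 2) (hy : y < 2)
    (B : Finset ℕ) : SuccCoords k m b P Q (codeVert b P y B) (codeHoriz Q x B) where
  toChainCoords := h
  pv_half d hd := by
    unfold codeVert
    split_ifs with h1 h2
    · subst h1; omega
    · rw [halfSibling_half, h.P_half d (by omega)]
    · exact h.P_half d (by omega)
  qh_half d hd := by
    cases d with
    | zero => simp only [codeHoriz]; omega
    | succ d =>
      simp only [codeHoriz]
      split_ifs
      · rw [halfSibling_half, h.Q_half d hd]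
      · exact h.Q_half d hd
  link d hd := by
    simp only [codeHoriz, codeVert, if_neg hd.ne]
    split_ifs
    · exact iff_of_false (halfSibling_ne _) (halfSibling_ne _)
    · simp

lemma succBreaks_code {B : Finset ℕ} (hB : B ⊆ Finset.range b) (y : ℕ) :
    succBreaks b P (codeVert b P y B) = B := by
  ext d
  rw [mem_succBreaks]
  constructor
  · rintro ⟨hd, hne⟩
    by_contra hdB
    simp [codeVert, hd.ne, hdB] at hne
  · intro hdB
    have hd := Finset.mem_range.1 (hB hdB)
    refine ⟨hd, ?_⟩
    simpa [codeVert, hd.ne, hdB] using halfSibling_ne _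

end ChainCoords

namespace SuccCoords

variable {k m b : ℕ} {P Q pv qh pv' qh' : ℕ → ℕ}

lemma exists_code (h : SuccCoords k m b P Q pv qh) :
    ∃ x < 2, ∃ y < 2, ∀ d ≤ b, pv d = codeVert b P y (succBreaks b P pv) d ∧
      qh d = codeHoriz Q x (succBreaks b P pv) d := by
  have h1 := h.pv_half b le_rfl
  have h2 := h.qh_half 0 (Nat.zero_le b)
  refine ⟨qh 0 - 2 * Q 0, by omega, pv b - 2 * P b, by omega, fun d hd => ⟨?_, ?_⟩⟩
  · unfold codeVert
    split_ifs with h3 h4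
    · subst h3; omega
    · have h5 := mem_succBreaks.1 h4
      exact eq_halfSibling ((h.pv_half d hd).trans (h.P_half d h5.1).symm) h5.2
    · rw [mem_succBreaks] at h4
      by_contra hne
      exact h4 ⟨by omega, hne⟩
  · cases d with
    | zero => simp only [codeHoriz]; omega
    | succ d =>
      simp only [codeHoriz]
      split_ifs with h4
      · have h5 := mem_succBreaks.1 h4
        exact eq_halfSibling ((h.qh_half (d + 1) hd).trans (h.Q_half d h5.1).symm)
          (fun heq => h5.2 ((h.link d hd).2 heq))
      · rw [mem_succBreaks] at h4
        by_contra hne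
        exact h4 ⟨hd, fun heq => hne ((h.link d hd).1 heq)⟩

lemma succTiles_congr (hv : ∀ d ≤ b, pv d = pv' d ∧ qh d = qh' d) :
    succTiles k m P Q pv qh 0 b = succTiles k m P Q pv' qh' 0 b := by
  ext t
  simp only [succTiles, Set.mem_ofPred_eq]
  refine exists_congr fun d => and_congr_right fun _ => and_congr_right fun hd => ?_
  rw [(hv d hd).1, (hv d hd).2]

lemma eq_of_succTiles_eq (h : SuccCoords k m b P Q pv qh)
    (heq : succTiles k m P Q pv' qh' 0 b = succTiles k m P Q pv qh 0 b) {d : ℕ} (hd : d ≤ b) :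
    pv' d = pv d ∧ qh' d = qh d :=
  ⟨h.eq_pv_of_mem (heq ▸ ⟨d, Nat.zero_le d, hd, Or.inr rfl⟩),
    h.eq_qh_of_mem hd (heq ▸ ⟨d, Nat.zero_le d, hd, Or.inl rfl⟩)⟩

end SuccCoords

namespace ChainCoords

variable {k m b : ℕ} {P Q : ℕ → ℕ}

lemma isHorizChild_iff (h : ChainCoords k m b P Q) {d : ℕ} (hd : d ≤ b) {v : Set (ℝ × ℝ)} :
    IsHorizChild v (levelTile k (m + d) (P d) (Q d)) ↔
      ∃ c, c / 2 = Q d ∧ v = levelTile (k + 1) (m + d) (P d) c :=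
  _root_.isHorizChild_iff (by have := h.le; omega) (h.P_lt d hd) (h.Q_lt d hd)

lemma isVertChild_iff (h : ChainCoords k m b P Q) {d : ℕ} (hd : d ≤ b) {v : Set (ℝ × ℝ)} :
    IsVertChild v (levelTile k (m + d) (P d) (Q d)) ↔
      ∃ a, a / 2 = P d ∧ v = levelTile (k + 1) (m + (d + 1)) a (Q d) :=
  _root_.isVertChild_iff (h.P_lt d hd) (h.Q_lt d hd)

lemma isSuccessorOf_iff (h : ChainCoords k m b P Q) {S : Set (Set (ℝ × ℝ))} :
    IsSuccessorOf (chainTiles k m b P Q) S ↔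
      ∃ pv qh, SuccCoords k m b P Q pv qh ∧ S = succTiles k m P Q pv qh 0 b := by
  constructor
  · rintro ⟨hS, hH, hV⟩
    have hH' : ∀ d, ∃ c, d ≤ b → c / 2 = Q d ∧ levelTile (k + 1) (m + d) (P d) c ∈ S ∧
        ∀ c', c' / 2 = Q d → levelTile (k + 1) (m + d) (P d) c' ∈ S → c' = c := by
      intro d
      by_cases hd : d ≤ b
      · obtain ⟨v, ⟨hvS, hv⟩, huniq⟩ := hH _ ⟨d, hd, rfl⟩
        obtain ⟨c, hc, rfl⟩ := (h.isHorizChild_iff hd).1 hv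
        refine ⟨c, fun _ => ⟨hc, hvS, fun c' hc' hmem => ?_⟩⟩
        exact (levelTile_inj.1 (huniq _ ⟨hmem, (h.isHorizChild_iff hd).2 ⟨c', hc', rfl⟩⟩)).2.2
      · exact ⟨0, fun h => absurd h hd⟩
    have hV' : ∀ d, ∃ a, d ≤ b → a / 2 = P d ∧ levelTile (k + 1) (m + (d + 1)) a (Q d) ∈ S ∧
        ∀ a', a' / 2 = P d → levelTile (k + 1) (m + (d + 1)) a' (Q d) ∈ S → a' = a := by
      intro d
      by_cases hd : d ≤ b
      · obtain ⟨v, ⟨hvS, hv⟩, huniq⟩ := hV _ ⟨d, hd, rfl⟩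
        obtain ⟨a, ha, rfl⟩ := (h.isVertChild_iff hd).1 hv
        refine ⟨a, fun _ => ⟨ha, hvS, fun a' ha' hmem => ?_⟩⟩
        exact (levelTile_inj.1 (huniq _ ⟨hmem, (h.isVertChild_iff hd).2 ⟨a', ha', rfl⟩⟩)).2.1
      · exact ⟨0, fun h => absurd h hd⟩
    choose qh hqh using hH'
    choose pv hpv using hV'
    refine ⟨pv, qh, ⟨h, fun d hd => (hpv d hd).1, fun d hd => (hqh d hd).1, fun d hd => ?_⟩, ?_⟩
    · constructor
      · intro heq
        have hmem := (hpv d hd.le).2.1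
        rw [heq] at hmem
        exact ((hqh (d + 1) hd).2.2 _ (h.Q_half d hd) hmem).symm
      · intro heq
        have hmem := (hqh (d + 1) hd).2.1
        rw [heq] at hmem
        exact ((hpv d hd.le).2.2 _ (h.P_half d hd) hmem).symm
    · ext t
      constructor
      · intro ht
        obtain ⟨_, ⟨d, hd, rfl⟩, hc | hc⟩ := hS t ht
        · obtain ⟨c, hcQ, rfl⟩ := (h.isHorizChild_iff hd).1 hc
          exact ⟨d, Nat.zero_le d, hd, Or.inl (by rw [(hqh d hd).2.2 c hcQ ht])⟩
        · obtain ⟨a, ha, rfl⟩ := (h.isVertChild_iff hd).1 hc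
          exact ⟨d, Nat.zero_le d, hd, Or.inr (by rw [(hpv d hd).2.2 a ha ht])⟩
      · rintro ⟨d, -, hd, rfl | rfl⟩
        · exact (hqh d hd).2.1
        · exact (hpv d hd).2.1
  · rintro ⟨pv, qh, hs, rfl⟩
    refine ⟨?_, ?_, ?_⟩
    · rintro _ ⟨d, -, hd, rfl | rfl⟩
      · exact ⟨_, ⟨d, hd, rfl⟩, Or.inl ((h.isHorizChild_iff hd).2 ⟨_, hs.qh_half d hd, rfl⟩)⟩
      · exact ⟨_, ⟨d, hd, rfl⟩, Or.inr ((h.isVertChild_iff hd).2 ⟨_, hs.pv_half d hd, rfl⟩)⟩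
    · rintro _ ⟨d, hd, rfl⟩
      refine ⟨_, ⟨⟨d, Nat.zero_le d, hd, Or.inl rfl⟩,
        (h.isHorizChild_iff hd).2 ⟨_, hs.qh_half d hd, rfl⟩⟩, ?_⟩
      rintro v ⟨hv, hc⟩
      obtain ⟨c, -, rfl⟩ := (h.isHorizChild_iff hd).1 hc
      rw [hs.eq_qh_of_mem hd hv]
    · rintro _ ⟨d, hd, rfl⟩
      refine ⟨_, ⟨⟨d, Nat.zero_le d, hd, Or.inr rfl⟩,
        (h.isVertChild_iff hd).2 ⟨_, hs.pv_half d hd, rfl⟩⟩, ?_⟩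
      rintro v ⟨hv, hc⟩
      obtain ⟨a, -, rfl⟩ := (h.isVertChild_iff hd).1 hc
      rw [hs.eq_pv_of_mem hv]

/-- The successor with first choice `x`, last choice `y` and breaks `B`. -/
def codeSuccessor (k m b : ℕ) (P Q : ℕ → ℕ) (z : (ℕ × ℕ) × Finset ℕ) : Set (Set (ℝ × ℝ)) :=
  succTiles k m P Q (codeVert b P z.1.2 z.2) (codeHoriz Q z.1.1 z.2) 0 b

lemma ncard_successors (h : ChainCoords k m b P Q) (r : ℕ) :
    {S | IsSuccessorOf (chainTiles k m b P Q) S ∧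
      ∃ 𝒞, IsSeparateDecomposition (k + 1) 𝒞 S ∧ 𝒞.ncard = r + 1}.ncard =
      4 * Nat.choose b r := by
  classical
  let Z : Finset ((ℕ × ℕ) × Finset ℕ) :=
    (Finset.range 2 ×ˢ Finset.range 2) ×ˢ (Finset.range b).powersetCard r
  have hZ : ∀ {z}, z ∈ Z ↔ (z.1.1 < 2 ∧ z.1.2 < 2) ∧ z.2 ⊆ Finset.range b ∧ z.2.card = r := by
    simp [Z, Finset.mem_product, Finset.mem_powersetCard]
  have hset : {S | IsSuccessorOf (chainTiles k m b P Q) S ∧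
      ∃ 𝒞, IsSeparateDecomposition (k + 1) 𝒞 S ∧ 𝒞.ncard = r + 1} =
      codeSuccessor k m b P Q '' (Z : Set ((ℕ × ℕ) × Finset ℕ)) := by
    ext S
    constructor
    · rintro ⟨hS, 𝒞, h𝒞, hcard⟩
      obtain ⟨pv, qh, hs, rfl⟩ := h.isSuccessorOf_iff.1 hS
      obtain ⟨𝒟, h𝒟, hcard'⟩ := hs.exists_decomposition
      rw [h𝒞.unique h𝒟, hcard'] at hcard
      obtain ⟨x, hx, y, hy, hxy⟩ := hs.exists_code
      exact ⟨((x, y), succBreaks b P pv), hZ.2 ⟨⟨hx, hy⟩, Finset.filter_subset _ _, Nat.succ_injective hcard⟩,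
        (SuccCoords.succTiles_congr hxy).symm⟩
    · rintro ⟨z, hz, rfl⟩
      obtain ⟨⟨hx, hy⟩, hB, hr⟩ := hZ.1 hz
      have hs := h.succCoords_code hx hy z.2
      obtain ⟨𝒟, h𝒟, hcard⟩ := hs.exists_decomposition
      rw [succBreaks_code hB, hr] at hcard
      exact ⟨h.isSuccessorOf_iff.2 ⟨_, _, hs, rfl⟩, 𝒟, h𝒟, hcard⟩
  have hinj : Set.InjOn (codeSuccessor k m b P Q) (Z : Set ((ℕ × ℕ) × Finset ℕ)) := by
    rintro ⟨⟨x, y⟩, B⟩ hz ⟨⟨x', y'⟩, B'⟩ hz' heq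
    obtain ⟨⟨hx, hy⟩, hB, -⟩ := hZ.1 hz
    obtain ⟨⟨hx', hy'⟩, hB', -⟩ := hZ.1 hz'
    dsimp only at hx hy hB hx' hy' hB'
    have hco := fun d (hd : d ≤ b) => (h.succCoords_code hx' hy' B').eq_of_succTiles_eq heq hd
    have hyy := (hco b le_rfl).1
    have hxx := (hco 0 (Nat.zero_le b)).2
    simp only [codeVert, codeHoriz, if_true] at hxx hyy
    have hBB : B = B' := by
      rw [← succBreaks_code (P := P) hB y, ← succBreaks_code (P := P) hB' y']
      refine Finset.filter_congr fun d hd => ?_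
      rw [(hco d (Finset.mem_range.1 hd).le).1]
    obtain rfl : x = x' := by omega
    obtain rfl : y = y' := by omega
    rw [hBB]
  rw [hset, hinj.ncard_image, Set.ncard_coe_finset]
  simp [Z]

end ChainCoords

/-- every successor of an order-`k` chain with `b` bonds is uniquely a union
of pairwise separate order-`(k+1)` chains, has exactly `b+1` bonds in total, and for each
`r ≤ b` there are exactly `4·C(b,r)` successors decomposing into `r+1` separate chains. -/
theorem successor_structure (k b : ℕ) (C : Set (Set (ℝ × ℝ)))
    (hC : IsChainOf k C) (hb : bondCount k C = b) :
    (∀ S : Set (Set (ℝ × ℝ)), IsSuccessorOf C S →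
      (∃! 𝒞 : Set (Set (Set (ℝ × ℝ))),
        (∀ D ∈ 𝒞, IsChainOf (k + 1) D) ∧
        𝒞.Pairwise (SeparateChains (k + 1)) ∧ ⋃₀ 𝒞 = S) ∧
      bondCount (k + 1) S = b + 1) ∧
    (∀ r : ℕ, r ≤ b →
      {S : Set (Set (ℝ × ℝ)) | IsSuccessorOf C S ∧
        ∃ 𝒞 : Set (Set (Set (ℝ × ℝ))),
          (∀ D ∈ 𝒞, IsChainOf (k + 1) D) ∧
          𝒞.Pairwise (SeparateChains (k + 1)) ∧ ⋃₀ 𝒞 = S ∧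
          𝒞.ncard = r + 1}.ncard = 4 * Nat.choose b r) := by
  obtain ⟨m, b', P, Q, h, rfl⟩ := isChainOf_iff.1 hC
  obtain rfl : b' = b := h.bondCount.symm.trans hb
  refine ⟨fun S hS => ?_, fun r _ => ?_⟩
  · obtain ⟨pv, qh, hs, rfl⟩ := h.isSuccessorOf_iff.1 hS
    obtain ⟨𝒞, h𝒞, -⟩ := hs.exists_decomposition
    exact ⟨⟨𝒞, h𝒞, fun 𝒟 h𝒟 => IsSeparateDecomposition.unique h𝒟 h𝒞⟩, hs.bondCount⟩
  · rw [← h.ncard_successors r]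
    simp only [IsSeparateDecomposition, and_assoc]

end
end
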